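/- There exists a universal constant c₃ > 0 such that the following holds. Let Ω ⊆ ℝ³ be open, T ∈ (0,∞), let (u,d,p) have the standard regularity on Ω_T and satisfy the weak pressure equation −∫_{Ω_T} pΔψ dz = ∫_{Ω_T}(u⊗u+∇d⊙∇d):∇²ψ dz for all ψ∈C_c^∞(Ω_T). Then for every z₀ ∈ ℝ³×ℝ and ρ > 0 with Q*_ρ(z₀) ⊆ Ω_T and every γ ∈ (0,1/2]: D(γρ) ≤ c₃ ( γ ( D(ρ) + A(ρ)^{3/4}B(ρ)^{3/4} + C(ρ)^{1/2} ) + γ^{−5} A(ρ)^{3/4} B(ρ)^{3/2} ). -/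

import Mathlib

open MeasureTheory Set Filter
open scoped ENNReal NNReal

noncomputable section

abbrev E3 : Type := EuclideanSpace ℝ (Fin 3)

/-- Space-time `ℝ³ × ℝ`. -/
abbrev SpT : Type := E3 × ℝ

/-- Spatial partial derivative `∂_j` of a function on space-time. -/
def sderiv (j : Fin 3) (ψ : SpT → ℝ) (z : SpT) : ℝ :=
  fderiv ℝ ψ z ((EuclideanSpace.single j 1 : E3), (0 : ℝ))

/-- Time derivative `∂_t` of a function on space-time. -/
def tderiv (ψ : SpT → ℝ) (z : SpT) : ℝ :=
  fderiv ℝ ψ z ((0 : E3), (1 : ℝ))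

/-- Spatial Laplacian of a function on space-time. -/
def sLap (ψ : SpT → ℝ) (z : SpT) : ℝ := ∑ j, sderiv j (sderiv j ψ) z

/-- `ψ ∈ C_c^∞(U)`. -/
def IsTestOn (U : Set SpT) (ψ : SpT → ℝ) : Prop :=
  ContDiff ℝ (⊤ : ℕ∞) ψ ∧ HasCompactSupport ψ ∧ tsupport ψ ⊆ U

/-- `g` is the weak spatial gradient of `f` on `U`. -/
def WeakSGrad (U : Set SpT) (f : SpT → ℝ) (g : Fin 3 → SpT → ℝ) : Prop :=
  ∀ (j : Fin 3) (ψ : SpT → ℝ), IsTestOn U ψ →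
    ∫ z in U, f z * sderiv j ψ z = - ∫ z in U, g j z * ψ z

/-- Squared Frobenius norm of a `3×3` array, e.g. `|∇v|² = Σ_{i,j} (∂_j v_i)²`. -/
def nsq2 (M : Fin 3 → Fin 3 → ℝ) : ℝ := ∑ i, ∑ j, (M i j) ^ 2

/-- Squared norm of a `3×3×3` array, e.g. `|∇²d|² = Σ_{i,j,k} (∂_j ∂_k d_i)²`. -/
def nsq3 (A : Fin 3 → Fin 3 → Fin 3 → ℝ) : ℝ := ∑ i, ∑ j, ∑ k, (A i j k) ^ 2

/-- Open Euclidean ball in `ℝ³`. -/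
def ball3 (x : E3) (r : ℝ) : Set E3 := Metric.ball x r

/-- Parabolic cylinder `Q_r(z₀) = B_r(x₀) × (t₀ - r², t₀)`. -/
def Qcyl (z : SpT) (r : ℝ) : Set SpT := ball3 z.1 r ×ˢ Ioo (z.2 - r ^ 2) z.2

/-- Centered parabolic cylinder `Q*_r(z₀) = B_r(x₀) × (t₀ - (7/8)r², t₀ + (1/8)r²)`. -/
def Qstar (z : SpT) (r : ℝ) : Set SpT :=
  ball3 z.1 r ×ˢ Ioo (z.2 - 7 / 8 * r ^ 2) (z.2 + 1 / 8 * r ^ 2)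

/-- The time interval `I*_r(t₀) = (t₀ - (7/8)r², t₀ + (1/8)r²)`. -/
def Istar (t₀ r : ℝ) : Set ℝ := Ioo (t₀ - 7 / 8 * r ^ 2) (t₀ + 1 / 8 * r ^ 2)

/-- `u` is weakly divergence free on `U`. -/
def DivFreeOn (U : Set SpT) (u : SpT → E3) : Prop :=
  ∀ ψ : SpT → ℝ, IsTestOn U ψ → ∫ z in U, ∑ j, u z j * sderiv j ψ z = 0

/-- The weak pressure equation `-Δp = ∇·(∇ᵀ·(u⊗u + ∇d⊙∇d))` on `U`. -/
def PressureEqOn (U : Set SpT) (u : SpT → E3) (p : SpT → ℝ)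
    (Dd : SpT → Fin 3 → Fin 3 → ℝ) : Prop :=
  ∀ ψ : SpT → ℝ, IsTestOn U ψ →
    -∫ z in U, p z * sLap ψ z =
      ∫ z in U, ∑ i, ∑ j, (u z i * u z j + ∑ k, Dd z k i * Dd z k j) *
        sderiv i (sderiv j ψ) z

/-- Standard regularity of `(u,d,p)` on `Ω_T`, with weak spatial gradients `Du`, `Dd`, `D2d`
(`Du z i j = ∂_j u_i`, `Dd z i j = ∂_j d_i`, `D2d z i j k = ∂_j ∂_k d_i`). -/
structure StdReg (Ω : Set E3) (T : ℝ) (u d : SpT → E3) (p : SpT → ℝ)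
    (Du Dd : SpT → Fin 3 → Fin 3 → ℝ) (D2d : SpT → Fin 3 → Fin 3 → Fin 3 → ℝ) : Prop where
  meas_u : Measurable u
  meas_d : Measurable d
  meas_p : Measurable p
  meas_Du : Measurable Du
  meas_Dd : Measurable Dd
  meas_D2d : Measurable D2d
  grad_u : ∀ i : Fin 3, WeakSGrad (Ω ×ˢ Ioo 0 T) (fun z => u z i) (fun j z => Du z i j)
  grad_d : ∀ i : Fin 3, WeakSGrad (Ω ×ˢ Ioo 0 T) (fun z => d z i) (fun j z => Dd z i j)
  grad_Dd : ∀ i k : Fin 3,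
    WeakSGrad (Ω ×ˢ Ioo 0 T) (fun z => Dd z i k) (fun j z => D2d z i j k)
  linf_u : ∃ M : ℝ, ∀ᵐ t ∂(volume.restrict (Ioo 0 T)), ∫ x in Ω, ‖u (x, t)‖ ^ 2 ≤ M
  linf_d : ∃ M : ℝ, ∀ᵐ t ∂(volume.restrict (Ioo 0 T)), ∫ x in Ω, ‖d (x, t)‖ ^ 2 ≤ M
  linf_Dd : ∃ M : ℝ, ∀ᵐ t ∂(volume.restrict (Ioo 0 T)), ∫ x in Ω, nsq2 (Dd (x, t)) ≤ M
  l2_Du : IntegrableOn (fun z => nsq2 (Du z)) (Ω ×ˢ Ioo 0 T)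
  l2_D2d : IntegrableOn (fun z => nsq3 (D2d z)) (Ω ×ˢ Ioo 0 T)
  l32_p : IntegrableOn (fun z => |p z| ^ ((3 : ℝ) / 2)) (Ω ×ˢ Ioo 0 T)

/-- `A(r) = (1/r) esssup_{t ∈ I*_r} ∫_{B_r} (|u|² + |∇d|²) dx`. -/
def AQ (u : SpT → E3) (Dd : SpT → Fin 3 → Fin 3 → ℝ) (z₀ : SpT) (r : ℝ) : ℝ≥0∞ :=
  (ENNReal.ofReal r)⁻¹ *
    essSup (fun t => ∫⁻ x in ball3 z₀.1 r, ENNReal.ofReal (‖u (x, t)‖ ^ 2 + nsq2 (Dd (x, t))))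
      (volume.restrict (Istar z₀.2 r))

/-- `B(r) = (1/r) ∫∫_{Q*_r} (|∇u|² + |∇²d|²) dz`. -/
def BQ (Du : SpT → Fin 3 → Fin 3 → ℝ) (D2d : SpT → Fin 3 → Fin 3 → Fin 3 → ℝ)
    (z₀ : SpT) (r : ℝ) : ℝ≥0∞ :=
  (ENNReal.ofReal r)⁻¹ * ∫⁻ z in Qstar z₀ r, ENNReal.ofReal (nsq2 (Du z) + nsq3 (D2d z))

/-- `C(r) = (1/r²) ∫∫_{Q*_r} (|u|³ + |∇d|³) dz`. -/
def CQ (u : SpT → E3) (Dd : SpT → Fin 3 → Fin 3 → ℝ) (z₀ : SpT) (r : ℝ) : ℝ≥0∞ :=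
  (ENNReal.ofReal (r ^ 2))⁻¹ *
    ∫⁻ z in Qstar z₀ r, ENNReal.ofReal (‖u z‖ ^ 3 + Real.sqrt (nsq2 (Dd z)) ^ 3)

/-- `D(r) = (1/r²) ∫∫_{Q*_r} |p|^{3/2} dz`. -/
def DQ (p : SpT → ℝ) (z₀ : SpT) (r : ℝ) : ℝ≥0∞ :=
  (ENNReal.ofReal (r ^ 2))⁻¹ * ∫⁻ z in Qstar z₀ r, ENNReal.ofReal (|p z| ^ ((3 : ℝ) / 2))

open Topology

theorem lintegral_mul_rpow_le {α : Type*} [MeasurableSpace α] {μ : Measure α}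
    {k h : α → ℝ≥0∞} (hk : AEMeasurable k μ) (hh : AEMeasurable h μ) (hk1 : ∫⁻ x, k x ∂μ ≤ 1)
    {r : ℝ} (hr : 1 ≤ r) :
    (∫⁻ x, k x * h x ∂μ) ^ r ≤ ∫⁻ x, k x * h x ^ r ∂μ := by
  have hr0 : 0 < r := by linarith
  have h1 : 0 ≤ 1 - 1 / r := by
    rw [sub_nonneg, div_le_one hr0]; exact hr
  have key := ENNReal.lintegral_mul_norm_pow_le (μ := μ) (f := fun x => k x * h x ^ r) (g := k)
    (hk.mul (hh.pow_const r)) hk (p := 1 / r) (q := 1 - 1 / r) (by positivity) h1 (by ring)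
  have e : ∀ x, (k x * h x ^ r) ^ (1 / r) * k x ^ (1 - 1 / r) = k x * h x := by
    intro x
    rw [ENNReal.mul_rpow_of_nonneg _ _ (by positivity), ← ENNReal.rpow_mul,
      mul_one_div_cancel hr0.ne', ENNReal.rpow_one, mul_right_comm,
      ← ENNReal.rpow_add_of_nonneg _ _ (by positivity) h1]
    simp
  simp only [e] at key
  calc (∫⁻ x, k x * h x ∂μ) ^ r
      ≤ ((∫⁻ x, k x * h x ^ r ∂μ) ^ (1 / r) * 1) ^ r := by
        refine ENNReal.rpow_le_rpow (key.trans ?_) hr0.le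
        gcongr
        exact ENNReal.rpow_le_one hk1 h1
    _ = _ := by
        rw [mul_one, ← ENNReal.rpow_mul, one_div_mul_cancel hr0.ne', ENNReal.rpow_one]

section Mollify

variable {E : Type*} [NormedAddCommGroup E] [NormedSpace ℝ E] [FiniteDimensional ℝ E]
  [MeasurableSpace E] [BorelSpace E] {μ : Measure E} [μ.IsAddHaarMeasure]

theorem lintegral_mollify_sub_rpow_le {f k : E → ℝ} (hf : Measurable f) (hk : Measurable k)
    (hk0 : ∀ y, 0 ≤ k y) (hki : Integrable k μ) (hk1 : ∫ y, k y ∂μ = 1) {r : ℝ} (hr : 1 ≤ r) :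
    ∫⁻ x, ‖(∫ y, k y * f (x - y) ∂μ) - f x‖ₑ ^ r ∂μ ≤
      ∫⁻ y, ENNReal.ofReal (k y) * ∫⁻ x, ‖f (x - y) - f x‖ₑ ^ r ∂μ ∂μ := by
  have hr0 : 0 < r := by linarith
  have hk1' : ∫⁻ y, ENNReal.ofReal (k y) ∂μ = 1 := by
    rw [← ofReal_integral_eq_lintegral_ofReal hki (ae_of_all _ hk0), hk1, ENNReal.ofReal_one]
  have hswap : ∫⁻ x, ∫⁻ y, ENNReal.ofReal (k y) * ‖f (x - y) - f x‖ₑ ^ r ∂μ ∂μ =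
      ∫⁻ y, ENNReal.ofReal (k y) * ∫⁻ x, ‖f (x - y) - f x‖ₑ ^ r ∂μ ∂μ := by
    rw [lintegral_lintegral_swap]
    · refine lintegral_congr fun y => ?_
      rw [lintegral_const_mul]
      fun_prop
    · apply Measurable.aemeasurable
      fun_prop
  rw [← hswap]
  by_cases htop : ∫⁻ x, ∫⁻ y, ENNReal.ofReal (k y) * ‖f (x - y) - f x‖ₑ ^ r ∂μ ∂μ = ∞
  · rw [htop]; exact le_top
  have hae := ae_lt_top (by
    refine Measurable.lintegral_prod_right' (f := fun z : E × E =>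
      ENNReal.ofReal (k z.2) * ‖f (z.1 - z.2) - f z.1‖ₑ ^ r) ?_
    fun_prop) htop
  refine lintegral_mono_ae ?_
  filter_upwards [hae] with x hx
  have hj := lintegral_mul_rpow_le (μ := μ) (k := fun y => ENNReal.ofReal (k y))
    (h := fun y => ‖f (x - y) - f x‖ₑ) (by fun_prop) (by fun_prop) hk1'.le hr
  have hint : Integrable (fun y => k y * (f (x - y) - f x)) μ := by
    refine ⟨by fun_prop, ?_⟩
    rw [HasFiniteIntegral]
    have : ∀ y, ‖k y * (f (x - y) - f x)‖ₑ = ENNReal.ofReal (k y) * ‖f (x - y) - f x‖ₑ := by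
      intro y
      rw [enorm_mul, Real.enorm_of_nonneg (hk0 y)]
    simp only [this]
    by_contra h
    rw [not_lt, top_le_iff] at h
    rw [h, ENNReal.top_rpow_of_pos hr0] at hj
    exact absurd hx (not_lt.2 hj)
  have heq : (∫ y, k y * f (x - y) ∂μ) - f x = ∫ y, k y * (f (x - y) - f x) ∂μ := by
    have h2 : Integrable (fun y => k y * f x) μ := hki.mul_const _
    have h3 : (fun y => k y * f (x - y)) =
        fun y => k y * (f (x - y) - f x) + k y * f x := by ext y; ring
    rw [h3, integral_add hint h2, integral_mul_const, hk1]
    ring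
  rw [heq]
  refine le_trans ?_ hj
  gcongr
  refine (enorm_integral_le_lintegral_enorm _).trans (le_of_eq ?_)
  refine lintegral_congr fun y => ?_
  rw [enorm_mul, Real.enorm_of_nonneg (hk0 y)]

theorem lintegral_translate_sub_le {f : E → ℝ} (hf : Measurable f) {r : ℝ} (hr : 1 ≤ r) (y : E) :
    ∫⁻ x, ‖f (x - y) - f x‖ₑ ^ r ∂μ ≤
      2 ^ (r - 1) * (2 * ∫⁻ x, ‖f x‖ₑ ^ r ∂μ) := by
  calc ∫⁻ x, ‖f (x - y) - f x‖ₑ ^ r ∂μ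
      ≤ ∫⁻ x, 2 ^ (r - 1) * (‖f (x - y)‖ₑ ^ r + ‖f x‖ₑ ^ r) ∂μ := by
        refine lintegral_mono fun x => ?_
        refine (ENNReal.rpow_le_rpow enorm_sub_le (by linarith)).trans ?_
        exact ENNReal.rpow_add_le_mul_rpow_add_rpow _ _ hr
    _ = _ := by
        rw [lintegral_const_mul _ (by fun_prop), lintegral_add_left (by fun_prop),
          lintegral_sub_right_eq_self (fun x => ‖f x‖ₑ ^ r) y, two_mul]

theorem tendsto_lintegral_translate_sub {f : E → ℝ} {r : ℝ} (hr : 1 ≤ r)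
    (hf : MemLp f (ENNReal.ofReal r) μ) :
    Tendsto (fun y => ∫⁻ x, ‖f (x - y) - f x‖ₑ ^ r ∂μ) (𝓝 0) (𝓝 0) := by
  have hr0 : 0 < r := by linarith
  have : Fact (1 ≤ ENNReal.ofReal r) := ⟨by simpa using ENNReal.ofReal_le_ofReal hr⟩
  let g : E → C(E, E) := fun y => ⟨fun x => x - y, by fun_prop⟩
  have hg : Continuous g := by
    refine ContinuousMap.continuous_of_continuous_uncurry _ ?_
    simp only [Function.uncurry_def, g, ContinuousMap.coe_mk]
    fun_prop
  have hgm : ∀ y, MeasurePreserving (g y) μ μ := fun y => measurePreserving_sub_right μ y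
  have hc := Continuous.compMeasurePreservingLp (f := fun _ : E => hf.toLp f)
    continuous_const hg hgm ENNReal.ofReal_ne_top
  have h0 := hc.tendsto 0
  rw [tendsto_iff_edist_tendsto_0] at h0
  have hrne : ENNReal.ofReal r ≠ 0 := by simpa using hr0
  have e : ∀ y, edist (Lp.compMeasurePreserving (g y) (hgm y) (hf.toLp f))
      (Lp.compMeasurePreserving (g 0) (hgm 0) (hf.toLp f)) ^ r =
      ∫⁻ x, ‖f (x - y) - f x‖ₑ ^ r ∂μ := by
    intro y
    rw [Lp.edist_def, eLpNorm_eq_lintegral_rpow_enorm_toReal hrne ENNReal.ofReal_ne_top,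
      ENNReal.toReal_ofReal hr0.le, ← ENNReal.rpow_mul, one_div_mul_cancel hr0.ne',
      ENNReal.rpow_one]
    refine lintegral_congr_ae ?_
    have h1 := Lp.coeFn_compMeasurePreserving (hf.toLp f) (hgm y)
    have h2 := Lp.coeFn_compMeasurePreserving (hf.toLp f) (hgm 0)
    have h3 := (hgm y).quasiMeasurePreserving.ae_eq_comp hf.coeFn_toLp
    have h4 := (hgm 0).quasiMeasurePreserving.ae_eq_comp hf.coeFn_toLp
    filter_upwards [h1, h2, h3, h4] with x h1 h2 h3 h4
    simp only [Pi.sub_apply, h1, h2, h3, h4]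
    simp [g]
  have h5 := ((ENNReal.continuous_rpow_const (y := r)).tendsto 0).comp h0
  rw [ENNReal.zero_rpow_of_pos hr0] at h5
  exact h5.congr e

end Mollify

/-- The negative Laplacian of `(‖y‖² + a²)^{-1/2}` on `ℝ³`. -/
def regKernel (a : ℝ) (y : E3) : ℝ := 3 * a ^ 2 * (‖y‖ ^ 2 + a ^ 2) ^ (-(5 / 2) : ℝ)

theorem measurable_regKernel (a : ℝ) : Measurable (regKernel a) := by
  unfold regKernel; fun_prop

theorem regKernel_nonneg (a : ℝ) (y : E3) : 0 ≤ regKernel a y := by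
  unfold regKernel; positivity

theorem regKernel_smul {a : ℝ} (ha : 0 < a) (y : E3) :
    regKernel a (a • y) = (a ^ 3)⁻¹ * regKernel 1 y := by
  unfold regKernel
  have h1 : ‖a • y‖ ^ 2 + a ^ 2 = a ^ 2 * (‖y‖ ^ 2 + 1 ^ 2) := by
    rw [norm_smul, Real.norm_of_nonneg ha.le]; ring
  rw [h1, Real.mul_rpow (by positivity) (by positivity), ← Real.rpow_natCast a 2,
    ← Real.rpow_mul ha.le]
  have h2 : a ^ (((2 : ℕ) : ℝ) * (-(5 / 2) : ℝ)) = (a ^ 5)⁻¹ := by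
    rw [← Real.rpow_natCast a 5, ← Real.rpow_neg ha.le]; congr 1; norm_num
  rw [h2, Real.rpow_natCast]
  field_simp

theorem integrable_regKernel_one : Integrable (regKernel 1) := by
  have := (integrable_rpow_neg_one_add_norm_sq (E := E3) (μ := volume) (r := 5)
    (by simp; norm_num)).const_mul 3
  refine this.congr (ae_of_all _ fun y => ?_)
  unfold regKernel
  dsimp only
  rw [one_pow, mul_one, add_comm]
  norm_num

/-- The total mass of `regKernel`. -/
def regMass : ℝ := ∫ y, regKernel 1 y

theorem regMass_pos : 0 < regMass := by
  unfold regMass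
  rw [integral_pos_iff_support_of_nonneg (regKernel_nonneg 1) integrable_regKernel_one]
  have : Function.support (regKernel 1) = univ := by
    ext y
    have : 0 < regKernel 1 y := by unfold regKernel; positivity
    simp [this.ne']
  rw [this]
  simp

theorem lintegral_comp_smul_E3 {a : ℝ} (ha : 0 < a) (g : E3 → ℝ≥0∞) :
    ∫⁻ y, g (a • y) = ENNReal.ofReal (a ^ 3)⁻¹ * ∫⁻ y, g y := by
  have h1 := Measure.map_addHaar_smul (volume : Measure E3) ha.ne'
  have h2 : MeasurableEmbedding (fun y : E3 => a • y) :=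
    (Homeomorph.smulOfNeZero a ha.ne').measurableEmbedding
  rw [← h2.lintegral_map (μ := volume) g, h1, lintegral_smul_measure]
  simp [abs_of_pos ha]

theorem integrable_regKernel {a : ℝ} (ha : 0 < a) : Integrable (regKernel a) := by
  have h := integrable_regKernel_one.const_mul ((a ^ 3)⁻¹)
  simp only [← regKernel_smul ha] at h
  exact (integrable_comp_smul_iff volume (regKernel a) ha.ne').1 h

theorem integral_regKernel {a : ℝ} (ha : 0 < a) : ∫ y, regKernel a y = regMass := by
  have h := Measure.integral_comp_smul_of_nonneg (volume : Measure E3) (regKernel a) a (hR := ha.le)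
  simp only [regKernel_smul ha, integral_const_mul, finrank_euclideanSpace, Fintype.card_fin,
    smul_eq_mul] at h
  have ha3 : (a ^ 3)⁻¹ ≠ 0 := by positivity
  exact (mul_left_cancel₀ ha3 h).symm

theorem tendsto_lintegral_regKernel_mollify {f : E3 → ℝ} (hf : Measurable f) (hfi : Integrable f) :
    Tendsto (fun n : ℕ => ∫⁻ x, ‖(∫ y, regMass⁻¹ * regKernel (1 / (n + 1)) y * f (x - y)) - f x‖ₑ)
      atTop (𝓝 0) := by
  set ω : E3 → ℝ≥0∞ := fun y => ∫⁻ x, ‖f (x - y) - f x‖ₑ ^ (1 : ℝ) with hω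
  have hωm : Measurable ω := by
    refine Measurable.lintegral_prod_left' (f := fun z : E3 × E3 =>
      ‖f (z.1 - z.2) - f z.1‖ₑ ^ (1 : ℝ)) ?_
    fun_prop
  have hωt : Tendsto ω (𝓝 0) (𝓝 0) := by
    refine tendsto_lintegral_translate_sub le_rfl ?_
    simpa using memLp_one_iff_integrable.2 hfi
  set c := 2 * ∫⁻ x, ‖f x‖ₑ with hc
  have hcfin : c ≠ ∞ := ENNReal.mul_ne_top (by simp) hfi.2.ne
  have hωb : ∀ y, ω y ≤ c := fun y => by
    have := lintegral_translate_sub_le (μ := volume) hf le_rfl y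
    simpa [hω, hc] using this
  have step : ∀ n : ℕ,
      ∫⁻ x, ‖(∫ y, regMass⁻¹ * regKernel (1 / (n + 1)) y * f (x - y)) - f x‖ₑ ≤
      ∫⁻ y, ENNReal.ofReal (regMass⁻¹ * regKernel 1 y) * ω ((1 / ((n : ℝ) + 1)) • y) := by
    intro n
    have ha : (0 : ℝ) < 1 / (n + 1) := by positivity
    set a : ℝ := 1 / (n + 1)
    have h := lintegral_mollify_sub_rpow_le (μ := volume) (f := f)
      (k := fun y => regMass⁻¹ * regKernel a y) hf
      ((measurable_regKernel a).const_mul _)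
      (fun y => mul_nonneg (inv_nonneg.2 regMass_pos.le) (regKernel_nonneg a y))
      ((integrable_regKernel ha).const_mul _)
      (by rw [integral_const_mul, integral_regKernel ha, inv_mul_cancel₀ regMass_pos.ne'])
      (le_refl 1)
    simp only [ENNReal.rpow_one] at h
    refine h.trans (le_of_eq ?_)
    have h3 := lintegral_comp_smul_E3 ha
      (fun y => ENNReal.ofReal (regMass⁻¹ * regKernel a y) * ω y)
    have ha3 : (0 : ℝ) < (a ^ 3)⁻¹ := by positivity
    simp only [regKernel_smul ha] at h3
    have h4 : ∀ y : E3, ENNReal.ofReal (regMass⁻¹ * ((a ^ 3)⁻¹ * regKernel 1 y)) * ω (a • y) =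
        ENNReal.ofReal (a ^ 3)⁻¹ * (ENNReal.ofReal (regMass⁻¹ * regKernel 1 y) * ω (a • y)) := by
      intro y
      rw [mul_left_comm, ENNReal.ofReal_mul ha3.le, mul_assoc]
    simp only [h4] at h3
    rw [lintegral_const_mul _ (by
      have := measurable_regKernel 1
      fun_prop)] at h3
    have h5 := (ENNReal.mul_right_inj (by simpa using ha3) ENNReal.ofReal_ne_top).1 h3
    rw [h5]
    simp [hω]
  refine tendsto_of_tendsto_of_tendsto_of_le_of_le tendsto_const_nhds ?_ (fun _ => zero_le) step
  have hk := measurable_regKernel 1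
  have hki := (integrable_regKernel_one.const_mul regMass⁻¹)
  have hlim := tendsto_lintegral_of_dominated_convergence (μ := (volume : Measure E3))
    (F := fun (n : ℕ) y => ENNReal.ofReal (regMass⁻¹ * regKernel 1 y) * ω ((1 / ((n : ℝ) + 1)) • y))
    (f := fun _ => 0)
    (bound := fun y => ENNReal.ofReal (regMass⁻¹ * regKernel 1 y) * c)
    (fun n => by fun_prop) (fun n => ae_of_all _ fun y => mul_le_mul' le_rfl (hωb _))
    (by
      rw [lintegral_mul_const _ (by fun_prop)]
      refine ENNReal.mul_ne_top ?_ hcfin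
      rw [← ofReal_integral_eq_lintegral_ofReal hki (ae_of_all _ fun y =>
        mul_nonneg (inv_nonneg.2 regMass_pos.le) (regKernel_nonneg 1 y))]
      exact ENNReal.ofReal_ne_top)
    (ae_of_all _ fun y => by
      have h1 : Tendsto (fun n : ℕ => (1 / ((n : ℝ) + 1)) • y) atTop (𝓝 0) := by
        simpa using (tendsto_one_div_add_atTop_nhds_zero_nat (𝕜 := ℝ)).smul_const y
      have h2 := ENNReal.Tendsto.const_mul (a := ENNReal.ofReal (regMass⁻¹ * regKernel 1 y))
        (hωt.comp h1) (Or.inr ENNReal.ofReal_ne_top)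
      simpa using h2)
  simpa using hlim

/-- A pointwise bound on all regularizations of `f` passes to `f`. -/
theorem ae_enorm_le_of_regKernel_le {f : E3 → ℝ} (hf : Measurable f) (hfi : Integrable f)
    {U : Set E3} {M : E3 → ℝ≥0∞} (hM : Measurable M)
    (h : ∀ n : ℕ, ∀ᵐ x ∂(volume.restrict U),
      ‖∫ y, regKernel (1 / (n + 1)) y * f (x - y)‖ₑ ≤ M x) :
    ∀ᵐ x ∂(volume.restrict U), ‖f x‖ₑ ≤ ENNReal.ofReal regMass⁻¹ * M x := by
  have hz : ∫⁻ x in U, (‖f x‖ₑ - ENNReal.ofReal regMass⁻¹ * M x) = 0 := by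
    refine le_antisymm (ge_of_tendsto' (tendsto_lintegral_regKernel_mollify hf hfi) fun n => ?_)
      zero_le
    refine le_trans ?_ (setLIntegral_le_lintegral U _)
    refine lintegral_mono_ae ?_
    filter_upwards [h n] with x hx
    rw [tsub_le_iff_left]
    simp only [mul_assoc, integral_const_mul]
    set I := ∫ y, regKernel (1 / (n + 1)) y * f (x - y)
    calc ‖f x‖ₑ = ‖regMass⁻¹ * I - (regMass⁻¹ * I - f x)‖ₑ := by congr 1; ring
      _ ≤ ‖regMass⁻¹ * I‖ₑ + ‖regMass⁻¹ * I - f x‖ₑ := enorm_sub_le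
      _ ≤ _ := by
        rw [enorm_mul, Real.enorm_of_nonneg (inv_nonneg.2 regMass_pos.le)]
        gcongr
  rw [lintegral_eq_zero_iff (by fun_prop)] at hz
  filter_upwards [hz] with x hx
  exact tsub_eq_zero_iff_le.1 hx

section Mollifier

variable {E : Type*} [NormedAddCommGroup E] [NormedSpace ℝ E] [FiniteDimensional ℝ E]
  [MeasurableSpace E] [BorelSpace E]

/-- A bump function at the origin supported in the closed ball of radius `1 / (n + 1)`. -/
def stdBump (E : Type*) [NormedAddCommGroup E] [NormedSpace ℝ E] [FiniteDimensional ℝ E] (n : ℕ) :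
    ContDiffBump (0 : E) where
  rIn := 1 / (2 * (n + 1))
  rOut := 1 / (n + 1)
  rIn_pos := by positivity
  rIn_lt_rOut := by
    apply one_div_lt_one_div_of_lt
    · positivity
    · have : (0 : ℝ) < n + 1 := by positivity
      linarith

/-- Mollification of `f` at scale `1 / (n + 1)`. -/
def mollify (μ : Measure E) (n : ℕ) (f : E → ℝ) (x : E) : ℝ :=
  ∫ y, (stdBump E n).normed μ y * f (x - y) ∂μ

variable {μ : Measure E} [μ.IsAddHaarMeasure]

theorem mollify_eq_convolution (n : ℕ) (f : E → ℝ) :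
    mollify μ n f = convolution ((stdBump E n).normed μ) f (ContinuousLinearMap.lsmul ℝ ℝ) μ := by
  ext x; simp [mollify, convolution_def]

theorem contDiff_mollify (n : ℕ) {f : E → ℝ} (hf : LocallyIntegrable f μ) :
    ContDiff ℝ (⊤ : ℕ∞) (mollify μ n f) := by
  rw [mollify_eq_convolution]
  exact (stdBump E n).hasCompactSupport_normed.contDiff_convolution_left _
    (stdBump E n).contDiff_normed hf

theorem fderiv_mollify (n : ℕ) {f : E → ℝ} (hf : LocallyIntegrable f μ) (x e : E) :
    fderiv ℝ (mollify μ n f) x e =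
      ∫ y, fderiv ℝ ((stdBump E n).normed μ) (x - y) e * f y ∂μ := by
  have hc := (stdBump E n).hasCompactSupport_normed (μ := μ)
  have hd : ContDiff ℝ 1 ((stdBump E n).normed μ) := (stdBump E n).contDiff_normed (n := 1)
  rw [mollify_eq_convolution, ← convolution_flip,
    (hc.hasFDerivAt_convolution_right _ hf hd x).fderiv,
    convolution_precompR_apply _ hf (hc.fderiv ℝ) (hd.continuous_fderiv one_ne_zero)]
  simp [convolution_def]

theorem lintegral_mollify_sub_le (n : ℕ) {f : E → ℝ} (hf : Measurable f) {r : ℝ} (hr : 1 ≤ r)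
    {c : ℝ≥0∞} (h : ∀ y : E, ‖y‖ < 1 / (n + 1) → ∫⁻ x, ‖f (x - y) - f x‖ₑ ^ r ∂μ ≤ c) :
    ∫⁻ x, ‖mollify μ n f x - f x‖ₑ ^ r ∂μ ≤ c := by
  have hcont := ((stdBump E n).contDiff_normed (μ := μ) (n := 0)).continuous
  refine (lintegral_mollify_sub_rpow_le hf hcont.measurable
    (stdBump E n).nonneg_normed (stdBump E n).integrable_normed
    (stdBump E n).integral_normed hr).trans ?_
  calc _ ≤ ∫⁻ y, ENNReal.ofReal ((stdBump E n).normed μ y) * c ∂μ := by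
        refine lintegral_mono fun y => ?_
        by_cases hy : ‖y‖ < 1 / (n + 1)
        · exact mul_le_mul' le_rfl (h y hy)
        · have : y ∉ Function.support ((stdBump E n).normed μ) := by
            rw [ContDiffBump.support_normed_eq]
            simpa [stdBump] using hy
          rw [Function.notMem_support] at this
          simp [this]
    _ = c := by
        rw [lintegral_mul_const _ (by fun_prop),
          ← ofReal_integral_eq_lintegral_ofReal (stdBump E n).integrable_normed
            (ae_of_all _ (stdBump E n).nonneg_normed), (stdBump E n).integral_normed]
        simp

theorem tendsto_lintegral_mollify_sub {f : E → ℝ} (hf : Measurable f) {r : ℝ} (hr : 1 ≤ r)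
    (hfp : MemLp f (ENNReal.ofReal r) μ) :
    Tendsto (fun n => ∫⁻ x, ‖mollify μ n f x - f x‖ₑ ^ r ∂μ) atTop (𝓝 0) := by
  rw [ENNReal.tendsto_atTop_zero]
  intro ε hε
  have h := tendsto_lintegral_translate_sub hr hfp
  have h1 := (h.eventually (ge_mem_nhds hε))
  obtain ⟨δ, hδ, hball⟩ := Metric.eventually_nhds_iff.1 h1
  obtain ⟨N, hN⟩ := exists_nat_one_div_lt hδ
  refine ⟨N, fun n hn => lintegral_mollify_sub_le n hf hr fun y hy => hball ?_⟩
  rw [dist_zero_right]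
  refine hy.trans (lt_of_le_of_lt ?_ hN)
  have : (N : ℝ) ≤ n := by exact_mod_cast hn
  gcongr

theorem memLp_two_mollify (n : ℕ) {f : E → ℝ} (hf : Measurable f) (hfp : MemLp f 2 μ) :
    MemLp (mollify μ n f) 2 μ := by
  have h1 : MemLp (fun x => mollify μ n f x - f x) 2 μ := by
    have hcm := (contDiff_mollify n (hfp.locallyIntegrable (by norm_num))).continuous.measurable
    refine ⟨(hcm.sub hf).aestronglyMeasurable, ?_⟩
    rw [eLpNorm_lt_top_iff_lintegral_rpow_enorm_lt_top (by simp) (by simp)]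
    have h2 := lintegral_mollify_sub_le (μ := μ) n hf (r := 2) (by norm_num)
      (fun y _ => lintegral_translate_sub_le hf (by norm_num) y)
    refine lt_of_le_of_lt (by simpa using h2) ?_
    refine ENNReal.mul_lt_top (ENNReal.rpow_lt_top_of_nonneg (by norm_num) (by simp))
      (ENNReal.mul_lt_top (by simp) ?_)
    have := (eLpNorm_lt_top_iff_lintegral_rpow_enorm_lt_top (by simp) (by simp)).1 hfp.2
    simpa using this
  have h3 := h1.add hfp
  have h4 : mollify μ n f = (fun x => mollify μ n f x - f x) + f := by ext x; simp
  rwa [h4]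

theorem tendsto_integral_mul_mollify {f h : E → ℝ} (hf : Measurable f) (hfp : MemLp f 2 μ)
    (hh : MemLp h 2 μ) :
    Tendsto (fun n => ∫ x, h x * mollify μ n f x ∂μ) atTop (𝓝 (∫ x, h x * f x ∂μ)) := by
  rw [tendsto_iff_edist_tendsto_0]
  have hlim : Tendsto (fun n => (∫⁻ x, ‖h x‖ₑ ^ (2 : ℝ) ∂μ) ^ (1 / 2 : ℝ) *
      (∫⁻ x, ‖mollify μ n f x - f x‖ₑ ^ (2 : ℝ) ∂μ) ^ (1 / 2 : ℝ)) atTop (𝓝 0) := by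
    have h1 := tendsto_lintegral_mollify_sub (μ := μ) hf (r := 2) (by norm_num) (by simpa using hfp)
    have h2 := ((ENNReal.continuous_rpow_const (y := (1 / 2 : ℝ))).tendsto 0).comp h1
    rw [ENNReal.zero_rpow_of_pos (by norm_num)] at h2
    have h3 : (∫⁻ x, ‖h x‖ₑ ^ (2 : ℝ) ∂μ) ^ (1 / 2 : ℝ) ≠ ∞ := by
      have := (eLpNorm_lt_top_iff_lintegral_rpow_enorm_lt_top (by simp) (by simp)).1 hh.2
      refine ENNReal.rpow_ne_top_of_nonneg (by norm_num) ?_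
      simpa using this.ne
    simpa using ENNReal.Tendsto.const_mul h2 (Or.inr h3)
  refine tendsto_of_tendsto_of_tendsto_of_le_of_le tendsto_const_nhds hlim (fun _ => zero_le)
    fun n => ?_
  have hm := memLp_two_mollify n hf hfp
  dsimp only
  have hi1 : Integrable (fun x => h x * mollify μ n f x) μ := hh.integrable_mul hm
  have hi2 : Integrable (fun x => h x * f x) μ := hh.integrable_mul hfp
  rw [edist_eq_enorm_sub, ← integral_sub hi1 hi2]
  refine (enorm_integral_le_lintegral_enorm _).trans ?_
  have := ENNReal.lintegral_mul_le_Lp_mul_Lq μ (p := 2) (q := 2) (by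
    rw [Real.holderConjugate_iff]; norm_num) (f := fun x => ‖h x‖ₑ)
    (g := fun x => ‖mollify μ n f x - f x‖ₑ) hh.1.enorm (hm.1.sub hfp.1).enorm
  refine le_trans (le_of_eq ?_) this
  refine lintegral_congr fun x => ?_
  simp only [Pi.mul_apply]
  rw [← enorm_mul, mul_sub]

end Mollifier

instance : (volume : Measure SpT).IsAddHaarMeasure :=
  inferInstanceAs ((volume : Measure E3).prod (volume : Measure ℝ)).IsAddHaarMeasure

/-- The `j`-th spatial unit vector in space-time. -/
abbrev sdir (j : Fin 3) : SpT := (EuclideanSpace.single j 1, 0)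

theorem IsTestOn.sderiv {U : Set SpT} {ψ : SpT → ℝ} (h : IsTestOn U ψ) (j : Fin 3) :
    IsTestOn U (sderiv j ψ) := by
  obtain ⟨h1, h2, h3⟩ := h
  refine ⟨?_, ?_, ?_⟩
  · have : ContDiff ℝ (⊤ : ℕ∞) (fderiv ℝ ψ) := h1.fderiv_right (by simp)
    exact this.clm_apply contDiff_const
  · exact (h2.fderiv_apply ℝ (sdir j))
  · refine subset_trans (tsupport_fderiv_apply_subset ℝ (sdir j)) h3

theorem sderiv_mul {f g : SpT → ℝ} {z : SpT} (hf : DifferentiableAt ℝ f z)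
    (hg : DifferentiableAt ℝ g z) (j : Fin 3) :
    sderiv j (fun z => f z * g z) z = f z * sderiv j g z + g z * sderiv j f z := by
  unfold sderiv
  rw [fderiv_fun_mul hf hg]
  simp

/-- Mollification commutes with the weak derivative away from the boundary. -/
theorem sderiv_mollify {U : Set SpT} (hU : MeasurableSet U) {v v' : SpT → ℝ} {j : Fin 3}
    (hv : ∀ ψ, IsTestOn U ψ → ∫ z in U, v z * sderiv j ψ z = - ∫ z in U, v' z * ψ z)
    (hloc : LocallyIntegrable (U.indicator v) (volume : Measure SpT)) {n : ℕ} {z : SpT}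
    (hz : Metric.closedBall z (1 / (n + 1)) ⊆ U) :
    sderiv j (mollify volume n (U.indicator v)) z = mollify volume n (U.indicator v') z := by
  set k := (stdBump SpT n).normed volume with hk
  have hkd : ContDiff ℝ (⊤ : ℕ∞) k := (stdBump SpT n).contDiff_normed
  have htest : IsTestOn U (fun y => k (z - y)) := by
    have hts : tsupport (fun y => k (z - y)) ⊆ Metric.closedBall z (1 / (n + 1)) := by
      refine closure_minimal ?_ Metric.isClosed_closedBall
      intro y hy
      have : z - y ∈ Function.support k := hy
      rw [hk, ContDiffBump.support_normed_eq, mem_ball_zero_iff] at this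
      rw [Metric.mem_closedBall, dist_comm, dist_eq_norm]
      exact this.le
    refine ⟨hkd.comp (contDiff_const.sub contDiff_id), ?_, hts.trans hz⟩
    exact HasCompactSupport.of_support_subset_isCompact (isCompact_closedBall z (1 / (n + 1)))
      ((subset_tsupport _).trans hts)
  have hd : ∀ y, sderiv j (fun y => k (z - y)) y = - fderiv ℝ k (z - y) (sdir j) := by
    intro y
    have h1 : HasFDerivAt (fun y => k (z - y)) ((fderiv ℝ k (z - y)).comp
        (-ContinuousLinearMap.id ℝ SpT)) y := by
      have h2 : HasFDerivAt (fun y : SpT => z - y) (-ContinuousLinearMap.id ℝ SpT) y := by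
        simpa using (hasFDerivAt_id y).const_sub z
      exact ((hkd.differentiable (by simp)).differentiableAt.hasFDerivAt).comp y h2
    unfold sderiv
    rw [h1.fderiv]
    simp [sdir]
  have h1 := hv _ htest
  unfold sderiv
  rw [fderiv_mollify n hloc]
  have e1 : ∫ y, fderiv ℝ k (z - y) (sdir j) * U.indicator v y =
      - ∫ y in U, v y * sderiv j (fun y => k (z - y)) y := by
    rw [← integral_neg, ← integral_indicator hU]
    refine integral_congr_ae (ae_of_all _ fun y => ?_)
    dsimp only
    by_cases hy : y ∈ U
    · simp only [hy, indicator_of_mem]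
      rw [hd]
      ring
    · simp [hy]
  rw [e1, h1, neg_neg, ← integral_indicator hU]
  unfold mollify
  rw [← integral_sub_left_eq_self (fun y => _ * U.indicator v' (z - y)) volume z]
  refine integral_congr_ae (ae_of_all _ fun y => ?_)
  by_cases hy : y ∈ U <;> simp [hy, mul_comm, k]

theorem memLp_mul_of_continuous_hasCompactSupport {f g : SpT → ℝ}
    (hf : MemLp f 2 (volume : Measure SpT)) (hg : Continuous g) (hgc : HasCompactSupport g) :
    MemLp (fun z => f z * g z) 2 (volume : Measure SpT) := by
  obtain ⟨C, hC⟩ := hg.bounded_above_of_compact_support hgc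
  refine hf.of_le_mul (c := C) (hf.1.mul hg.aestronglyMeasurable) (ae_of_all _ fun z => ?_)
  rw [norm_mul, mul_comm]
  gcongr
  exact hC z

/-- The product rule for weak derivatives of square-integrable functions. -/
theorem weak_sderiv_mul {U : Set SpT} (hU : IsOpen U) {v w v' w' : SpT → ℝ} {j : Fin 3}
    (mv : Measurable v) (mv' : Measurable v')
    (lv : MemLp v 2 (volume.restrict U)) (lw : MemLp w 2 (volume.restrict U))
    (lv' : MemLp v' 2 (volume.restrict U)) (lw' : MemLp w' 2 (volume.restrict U))
    (hv : ∀ ψ, IsTestOn U ψ → ∫ z in U, v z * sderiv j ψ z = - ∫ z in U, v' z * ψ z)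
    (hw : ∀ ψ, IsTestOn U ψ → ∫ z in U, w z * sderiv j ψ z = - ∫ z in U, w' z * ψ z)
    {ψ : SpT → ℝ} (hψ : IsTestOn U ψ) :
    ∫ z in U, (v z * w z) * sderiv j ψ z = - ∫ z in U, (v' z * w z + v z * w' z) * ψ z := by
  have hUm := hU.measurableSet
  rw [← memLp_indicator_iff_restrict hUm] at lv lw lv' lw'
  have mvi := mv.indicator hUm
  have mv'i := mv'.indicator hUm
  have hloc := lv.locallyIntegrable (by norm_num)
  obtain ⟨hψ1, hψ2, hψ3⟩ := id hψ
  have hdψ := hψ.sderiv j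
  have hψc := hψ1.continuous
  have L1 := memLp_mul_of_continuous_hasCompactSupport lw hψc hψ2
  have L2 := memLp_mul_of_continuous_hasCompactSupport lw hdψ.1.continuous hdψ.2.1
  have L3 := memLp_mul_of_continuous_hasCompactSupport lw' hψc hψ2
  have t1 := tendsto_integral_mul_mollify mv'i lv' L1
  have t2 := tendsto_integral_mul_mollify mvi lv L2
  have t3 := tendsto_integral_mul_mollify mvi lv L3
  obtain ⟨δ, hδ, hδU⟩ := hψ2.exists_cthickening_subset_open hU hψ3
  obtain ⟨N, hN⟩ := exists_nat_one_div_lt hδ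
  have ev : ∀ᶠ n : ℕ in atTop,
      (∫ z, U.indicator w z * ψ z * mollify volume n (U.indicator v') z) +
      (∫ z, U.indicator w z * sderiv j ψ z * mollify volume n (U.indicator v) z) =
      - ∫ z, U.indicator w' z * ψ z * mollify volume n (U.indicator v) z := by
    filter_upwards [eventually_ge_atTop N] with n hn
    have hnδ : (1 : ℝ) / (n + 1) ≤ δ := by
      refine le_trans ?_ hN.le
      have : (N : ℝ) ≤ n := by exact_mod_cast hn
      gcongr
    have hm := contDiff_mollify n hloc
    have htest : IsTestOn U (fun z => mollify volume n (U.indicator v) z * ψ z) := by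
      refine ⟨hm.mul hψ1, hψ2.mul_left, ?_⟩
      exact (tsupport_mul_subset_right).trans hψ3
    have hw1 := hw _ htest
    rw [← integral_indicator hUm, ← integral_indicator hUm] at hw1
    have hder : ∀ z, ψ z * sderiv j (mollify volume n (U.indicator v)) z =
        ψ z * mollify volume n (U.indicator v') z := by
      intro z
      by_cases hz : z ∈ tsupport ψ
      · rw [sderiv_mollify hUm hv hloc]
        refine subset_trans ?_ hδU
        exact (Metric.closedBall_subset_closedBall hnδ).trans
          (Metric.closedBall_subset_cthickening hz δ)
      · simp [image_eq_zero_of_notMem_tsupport hz]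
    have i1 := L1.integrable_mul (memLp_two_mollify n mv'i lv')
    have i2 := L2.integrable_mul (memLp_two_mollify n mvi lv)
    have e1 := integral_add i1 i2
    simp only [Pi.mul_apply] at e1
    rw [← e1]
    refine Eq.trans ?_ (hw1.trans ?_)
    · refine integral_congr_ae (ae_of_all _ fun z => ?_)
      dsimp only
      by_cases hz : z ∈ U
      · simp only [hz, indicator_of_mem]
        rw [sderiv_mul (hm.differentiable (by simp)).differentiableAt
          (hψ1.differentiable (by simp)).differentiableAt, hder]
        ring
      · simp [hz]
    · congr 1
      refine integral_congr_ae (ae_of_all _ fun z => ?_)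
      dsimp only
      by_cases hz : z ∈ U
      · simp only [hz, indicator_of_mem]
        ring
      · simp [hz]
  have hlim := tendsto_nhds_unique_of_eventuallyEq (t1.add t2) t3.neg ev
  have j1 := L1.integrable_mul lv'
  have j2 := L2.integrable_mul lv
  have j3 := L3.integrable_mul lv
  have e2 := integral_add j1 j3
  simp only [Pi.mul_apply] at e2
  have e3 : ∫ z in U, (v z * w z) * sderiv j ψ z =
      ∫ z, U.indicator w z * sderiv j ψ z * U.indicator v z := by
    rw [← integral_indicator hUm]
    refine integral_congr_ae (ae_of_all _ fun z => ?_)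
    dsimp only
    by_cases hz : z ∈ U
    · simp only [hz, indicator_of_mem]; ring
    · simp [hz]
  have e4 : ∫ z in U, (v' z * w z + v z * w' z) * ψ z =
      ∫ z, U.indicator w z * ψ z * U.indicator v' z + U.indicator w' z * ψ z * U.indicator v z := by
    rw [← integral_indicator hUm]
    refine integral_congr_ae (ae_of_all _ fun z => ?_)
    dsimp only
    by_cases hz : z ∈ U
    · simp only [hz, indicator_of_mem]; ring
    · simp [hz]
  rw [e3, e4, e2]
  linarith

/-- The `j`-th partial derivative of a function on `ℝ³`. -/
def pderiv (j : Fin 3) (f : E3 → ℝ) (y : E3) : ℝ := fderiv ℝ f y (EuclideanSpace.single j 1)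

theorem contDiff_pderiv {f : E3 → ℝ} (hf : ContDiff ℝ (⊤ : ℕ∞) f) (j : Fin 3) :
    ContDiff ℝ (⊤ : ℕ∞) (pderiv j f) := by
  have : ContDiff ℝ (⊤ : ℕ∞) (fderiv ℝ f) := hf.fderiv_right (by simp)
  exact this.clm_apply contDiff_const

theorem pderiv_mul {f g : E3 → ℝ} (hf : Differentiable ℝ f) (hg : Differentiable ℝ g)
    (j : Fin 3) :
    pderiv j (fun y => f y * g y) = fun y => f y * pderiv j g y + g y * pderiv j f y := by
  ext y
  unfold pderiv
  rw [fderiv_fun_mul (hf y) (hg y)]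
  simp

theorem pderiv_add {f g : E3 → ℝ} (hf : Differentiable ℝ f) (hg : Differentiable ℝ g)
    (j : Fin 3) :
    pderiv j (fun y => f y + g y) = fun y => pderiv j f y + pderiv j g y := by
  ext y
  unfold pderiv
  rw [fderiv_fun_add (hf y) (hg y)]
  simp

theorem pderiv_pderiv_mul {f g : E3 → ℝ} (hf : ContDiff ℝ (⊤ : ℕ∞) f)
    (hg : ContDiff ℝ (⊤ : ℕ∞) g) (j : Fin 3) (y : E3) :
    pderiv j (pderiv j (fun y => f y * g y)) y =
      f y * pderiv j (pderiv j g) y + 2 * (pderiv j f y * pderiv j g y)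
        + g y * pderiv j (pderiv j f) y := by
  have hfd : Differentiable ℝ f := hf.differentiable (by simp)
  have hgd : Differentiable ℝ g := hg.differentiable (by simp)
  have hf1 : Differentiable ℝ (pderiv j f) := (contDiff_pderiv hf j).differentiable (by simp)
  have hg1 : Differentiable ℝ (pderiv j g) := (contDiff_pderiv hg j).differentiable (by simp)
  rw [pderiv_mul hfd hgd, pderiv_add (hfd.fun_mul hg1) (hgd.fun_mul hf1), pderiv_mul hfd hg1,
    pderiv_mul hgd hf1]
  ring

theorem pderiv_comp_smul_sub {f : E3 → ℝ} (hf : Differentiable ℝ f) (c : ℝ) (x₀ : E3)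
    (j : Fin 3) :
    pderiv j (fun y => f (c • (y - x₀))) = fun y => c * pderiv j f (c • (y - x₀)) := by
  ext y
  have h1 : HasFDerivAt (fun y : E3 => c • (y - x₀)) (c • ContinuousLinearMap.id ℝ E3) y :=
    ((hasFDerivAt_id y).sub_const x₀).const_smul c
  have h2 := (hf (c • (y - x₀))).hasFDerivAt.comp y h1
  unfold pderiv
  have h3 : fderiv ℝ (fun y => f (c • (y - x₀))) y = _ := h2.fderiv
  rw [h3]
  simp

theorem pderiv_const_mul {f : E3 → ℝ} (hf : Differentiable ℝ f) (c : ℝ) (j : Fin 3) :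
    pderiv j (fun y => c * f y) = fun y => c * pderiv j f y := by
  ext y
  unfold pderiv
  rw [fderiv_const_mul (hf y)]
  simp

theorem abs_le_of_hasCompactSupport {f : E3 → ℝ} (hf : Continuous f) (hc : HasCompactSupport f) :
    ∃ K, 0 ≤ K ∧ ∀ y, |f y| ≤ K := by
  obtain ⟨K, hK⟩ := hf.bounded_above_of_compact_support hc
  exact ⟨K, (norm_nonneg _).trans (hK 0), hK⟩

theorem hasCompactSupport_pderiv {f : E3 → ℝ} (hf : HasCompactSupport f) (j : Fin 3) :
    HasCompactSupport (pderiv j f) :=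
  hf.fderiv_apply ℝ _

/-- A cutoff function adapted to the ball `B_ρ(x₀)`. -/
structure IsCutoff (K : ℝ) (x₀ : E3) (ρ : ℝ) (η : E3 → ℝ) : Prop where
  smooth : ContDiff ℝ (⊤ : ℕ∞) η
  compact : HasCompactSupport η
  supp : tsupport η ⊆ Metric.ball x₀ ρ
  abs_le : ∀ y, |η y| ≤ 1
  eq_one : ∀ y ∈ Metric.ball x₀ (ρ / 2), η y = 1
  pderiv_le : ∀ j y, |pderiv j η y| ≤ K / ρ
  pderiv2_le : ∀ j y, |pderiv j (pderiv j η) y| ≤ K / ρ ^ 2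
  pderiv_eq : ∀ j, ∀ y ∈ Metric.ball x₀ (3 / 4 * ρ), pderiv j η y = 0
  pderiv2_eq : ∀ j, ∀ y ∈ Metric.ball x₀ (3 / 4 * ρ), pderiv j (pderiv j η) y = 0

theorem pderiv_eq_zero_of_eventuallyEq {f : E3 → ℝ} {c : ℝ} {y : E3}
    (h : f =ᶠ[𝓝 y] fun _ => c) (j : Fin 3) : pderiv j f y = 0 := by
  unfold pderiv
  rw [h.fderiv_eq]
  simp

theorem exists_isCutoff : ∃ K : ℝ, 0 ≤ K ∧ ∀ (x₀ : E3) (ρ : ℝ), 0 < ρ →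
    ∃ η, IsCutoff K x₀ ρ η := by
  let b : ContDiffBump (0 : E3) := ⟨3 / 4, 7 / 8, by norm_num, by norm_num⟩
  have hb : ContDiff ℝ (⊤ : ℕ∞) b := b.contDiff
  have hbc : HasCompactSupport b := b.hasCompactSupport
  choose K1 hK1 hK1' using fun j => abs_le_of_hasCompactSupport (contDiff_pderiv hb j).continuous
    (hasCompactSupport_pderiv hbc j)
  choose K2 hK2 hK2' using fun j => abs_le_of_hasCompactSupport
    (contDiff_pderiv (contDiff_pderiv hb j) j).continuous
    (hasCompactSupport_pderiv (hasCompactSupport_pderiv hbc j) j)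
  refine ⟨∑ j, K1 j + ∑ j, K2 j, add_nonneg (Finset.sum_nonneg fun j _ => hK1 j)
    (Finset.sum_nonneg fun j _ => hK2 j), fun x₀ ρ hρ => ?_⟩
  have hbd : Differentiable ℝ b := hb.differentiable (by simp)
  have hbd1 : ∀ j, Differentiable ℝ (pderiv j b) :=
    fun j => (contDiff_pderiv hb j).differentiable (by simp)
  have p1 : ∀ j, pderiv j (fun y => b (ρ⁻¹ • (y - x₀))) =
      fun y => ρ⁻¹ * pderiv j b (ρ⁻¹ • (y - x₀)) := fun j => pderiv_comp_smul_sub hbd _ _ j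
  have p2 : ∀ j, pderiv j (pderiv j (fun y => b (ρ⁻¹ • (y - x₀)))) =
      fun y => ρ⁻¹ * (ρ⁻¹ * pderiv j (pderiv j b) (ρ⁻¹ • (y - x₀))) := by
    intro j
    rw [p1, pderiv_const_mul (f := fun y => pderiv j b (ρ⁻¹ • (y - x₀))),
      pderiv_comp_smul_sub (hbd1 j)]
    exact (hbd1 j).comp ((differentiable_id.sub_const x₀).const_smul ρ⁻¹)
  have hnorm : ∀ y, ‖ρ⁻¹ • (y - x₀)‖ = dist y x₀ / ρ := by
    intro y
    rw [norm_smul, norm_inv, Real.norm_of_nonneg hρ.le, dist_eq_norm]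
    ring
  have hts : tsupport (fun y => b (ρ⁻¹ • (y - x₀))) ⊆ Metric.closedBall x₀ (7 / 8 * ρ) := by
    refine closure_minimal ?_ Metric.isClosed_closedBall
    intro y hy
    have : ρ⁻¹ • (y - x₀) ∈ Function.support b := hy
    rw [b.support_eq, mem_ball_zero_iff, hnorm, div_lt_iff₀ hρ] at this
    exact this.le
  have hev : ∀ y ∈ Metric.ball x₀ (3 / 4 * ρ),
      ∀ᶠ z in 𝓝 y, b (ρ⁻¹ • (z - x₀)) = 1 := by
    intro y hy
    filter_upwards [Metric.isOpen_ball.mem_nhds hy] with z hz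
    refine b.one_of_mem_closedBall ?_
    rw [mem_closedBall_zero_iff, hnorm, div_le_iff₀ hρ]
    exact (Metric.mem_ball.1 hz).le
  refine ⟨fun y => b (ρ⁻¹ • (y - x₀)), ?_, ?_, ?_, ?_, ?_, ?_, ?_, ?_, ?_⟩
  · exact hb.comp (by fun_prop : ContDiff ℝ (⊤ : ℕ∞) fun y : E3 => ρ⁻¹ • (y - x₀))
  · exact HasCompactSupport.of_support_subset_isCompact (isCompact_closedBall x₀ _)
      ((subset_tsupport _).trans hts)
  · exact hts.trans (Metric.closedBall_subset_ball (by linarith))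
  · intro y
    rw [abs_of_nonneg b.nonneg]
    exact b.le_one
  · intro y hy
    exact (hev y (Metric.ball_subset_ball (by linarith) hy)).self_of_nhds
  · intro j y
    rw [p1, abs_mul, abs_of_pos (inv_pos.2 hρ), div_eq_inv_mul]
    gcongr
    refine (hK1' j _).trans ((Finset.single_le_sum (fun j _ => hK1 j) (Finset.mem_univ j)).trans ?_)
    exact le_add_of_nonneg_right (Finset.sum_nonneg fun j _ => hK2 j)
  · intro j y
    rw [p2, abs_mul, abs_mul, abs_of_pos (inv_pos.2 hρ), ← mul_assoc, div_eq_inv_mul, sq, mul_inv]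
    gcongr
    refine (hK2' j _).trans ((Finset.single_le_sum (fun j _ => hK2 j) (Finset.mem_univ j)).trans ?_)
    exact le_add_of_nonneg_left (Finset.sum_nonneg fun j _ => hK1 j)
  · intro j y hy
    exact pderiv_eq_zero_of_eventuallyEq (hev y hy) j
  · intro j y hy
    refine pderiv_eq_zero_of_eventuallyEq (c := 0) ?_ j
    filter_upwards [Metric.isOpen_ball.mem_nhds hy] with z hz
    exact pderiv_eq_zero_of_eventuallyEq (hev z hz) j

/-- The regularised Newton potential centred at `x`. -/
def regNewton (a : ℝ) (x y : E3) : ℝ := (‖y - x‖ ^ 2 + a ^ 2) ^ (-(1 / 2) : ℝ)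

theorem contDiff_rpow_norm_sq_add {a : ℝ} (ha : 0 < a) (x : E3) (s : ℝ) :
    ContDiff ℝ (⊤ : ℕ∞) fun y : E3 => (‖y - x‖ ^ 2 + a ^ 2) ^ s :=
  (((contDiff_id.sub contDiff_const).norm_sq ℝ).add contDiff_const).rpow_const_of_ne
    fun y => by positivity

theorem pderiv_rpow_norm_sq_add {a : ℝ} (ha : 0 < a) (x : E3) (s : ℝ) (j : Fin 3) :
    pderiv j (fun y : E3 => (‖y - x‖ ^ 2 + a ^ 2) ^ s) =
      fun y => 2 * s * ((y - x) j * (‖y - x‖ ^ 2 + a ^ 2) ^ (s - 1)) := by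
  ext y
  have h1 : HasFDerivAt (fun y : E3 => ‖y - x‖ ^ 2 + a ^ 2) _ y :=
    (((hasFDerivAt_id y).sub_const x).norm_sq).add_const (a ^ 2)
  have h2 := h1.rpow_const (p := s) (Or.inl (by positivity))
  unfold pderiv
  rw [h2.fderiv]
  simp [EuclideanSpace.inner_single_right]
  ring

theorem pderiv_regNewton {a : ℝ} (ha : 0 < a) (x : E3) (j : Fin 3) (y : E3) :
    pderiv j (regNewton a x) y = -((y - x) j * (‖y - x‖ ^ 2 + a ^ 2) ^ (-(3 / 2) : ℝ)) := by
  have := congrFun (pderiv_rpow_norm_sq_add ha x (-(1 / 2)) j) y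
  refine Eq.trans this ?_
  norm_num

theorem pderiv_apply_sub (x : E3) (j : Fin 3) (y : E3) :
    pderiv j (fun y : E3 => (y - x) j) y = 1 := by
  have h : HasFDerivAt (fun y : E3 => (y - x) j) (EuclideanSpace.proj (𝕜 := ℝ) j : E3 →L[ℝ] ℝ) y :=
    (EuclideanSpace.proj (𝕜 := ℝ) j : E3 →L[ℝ] ℝ).hasFDerivAt.comp y
      ((hasFDerivAt_id y).sub_const x)
  unfold pderiv
  rw [h.fderiv]
  simp

theorem sum_pderiv_pderiv_regNewton {a : ℝ} (ha : 0 < a) (x y : E3) :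
    ∑ j, pderiv j (pderiv j (regNewton a x)) y = - regKernel a (y - x) := by
  have key : ∀ j, pderiv j (pderiv j (regNewton a x)) y =
      3 * (((y - x) j) ^ 2 * (‖y - x‖ ^ 2 + a ^ 2) ^ (-(5 / 2) : ℝ))
        - (‖y - x‖ ^ 2 + a ^ 2) ^ (-(3 / 2) : ℝ) := by
    intro j
    have e : pderiv j (regNewton a x) = fun y =>
        (-1) * ((y - x) j * (‖y - x‖ ^ 2 + a ^ 2) ^ (-(3 / 2) : ℝ)) := by
      ext y
      rw [pderiv_regNewton ha]
      ring
    have d1 : Differentiable ℝ (fun y : E3 => (y - x) j) := by fun_prop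
    have d2 : Differentiable ℝ (fun y : E3 => (‖y - x‖ ^ 2 + a ^ 2) ^ (-(3 / 2) : ℝ)) :=
      (contDiff_rpow_norm_sq_add ha x _).differentiable (by simp)
    rw [e, pderiv_const_mul (d1.fun_mul d2), pderiv_mul d1 d2, pderiv_rpow_norm_sq_add ha]
    dsimp only
    rw [pderiv_apply_sub]
    norm_num
    ring
  simp only [key]
  have hs : 0 < ‖y - x‖ ^ 2 + a ^ 2 := by positivity
  have e3 : (‖y - x‖ ^ 2 + a ^ 2) ^ (-(3 / 2) : ℝ) =
      (‖y - x‖ ^ 2 + a ^ 2) * (‖y - x‖ ^ 2 + a ^ 2) ^ (-(5 / 2) : ℝ) := by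
    rw [← Real.rpow_one_add' hs.le (by norm_num)]
    norm_num
  rw [e3]
  unfold regKernel
  have hn : ‖y - x‖ ^ 2 = ∑ j, ((y - x) j) ^ 2 := by
    rw [EuclideanSpace.norm_sq_eq]
    simp
  rw [Finset.sum_sub_distrib, ← Finset.mul_sum, ← Finset.sum_mul, ← hn]
  simp
  ring

theorem regNewton_mul_norm_le {a : ℝ} (ha : 0 < a) (x y : E3) :
    |regNewton a x y| * ‖y - x‖ ≤ 1 := by
  have hs : 0 < ‖y - x‖ ^ 2 + a ^ 2 := by positivity
  unfold regNewton
  rw [abs_of_pos (by positivity), Real.rpow_neg hs.le, ← Real.sqrt_eq_rpow, inv_mul_le_iff₀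
    (by positivity), mul_one]
  exact Real.le_sqrt_of_sq_le (by nlinarith)

theorem pderiv_regNewton_mul_norm_le {a : ℝ} (ha : 0 < a) (x y : E3) (j : Fin 3) :
    |pderiv j (regNewton a x) y| * ‖y - x‖ ^ 2 ≤ 1 := by
  have hs : 0 < ‖y - x‖ ^ 2 + a ^ 2 := by positivity
  have h1 := regNewton_mul_norm_le ha x y
  have h2 : |pderiv j (regNewton a x) y| ≤ ‖y - x‖ * |regNewton a x y| ^ 3 := by
    rw [pderiv_regNewton ha, abs_neg, abs_mul]
    unfold regNewton
    have e : |(‖y - x‖ ^ 2 + a ^ 2) ^ (-(3 / 2) : ℝ)| =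
        |(‖y - x‖ ^ 2 + a ^ 2) ^ (-(1 / 2) : ℝ)| ^ 3 := by
      rw [abs_of_pos (by positivity), abs_of_pos (by positivity), ← Real.rpow_natCast _ 3,
        ← Real.rpow_mul hs.le]
      norm_num
    rw [e]
    gcongr
    exact (PiLp.norm_apply_le (y - x) j)
  calc |pderiv j (regNewton a x) y| * ‖y - x‖ ^ 2
      ≤ (‖y - x‖ * |regNewton a x y| ^ 3) * ‖y - x‖ ^ 2 := by gcongr
    _ = (|regNewton a x y| * ‖y - x‖) ^ 3 := by ring
    _ ≤ 1 := pow_le_one₀ (by positivity) h1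

theorem IsTestOn.integrable_mul {U : Set SpT} {ψ F : SpT → ℝ} (hψ : IsTestOn U ψ)
    (hF : IntegrableOn F U) : IntegrableOn (fun z => F z * ψ z) U := by
  obtain ⟨C, hC⟩ := hψ.1.continuous.bounded_above_of_compact_support hψ.2.1
  exact hF.mul_bdd hψ.1.continuous.aestronglyMeasurable (ae_of_all _ hC)

/-- `F` and `F'` are integrable on `U` and `F'` is the weak derivative `∂_i F`. -/
structure WeakDeriv (U : Set SpT) (i : Fin 3) (F F' : SpT → ℝ) : Prop where
  int : IntegrableOn F U
  int' : IntegrableOn F' U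
  eq : ∀ ψ, IsTestOn U ψ → ∫ z in U, F z * sderiv i ψ z = - ∫ z in U, F' z * ψ z

theorem WeakDeriv.add {U : Set SpT} {i : Fin 3} {F F' G G' : SpT → ℝ} (hF : WeakDeriv U i F F')
    (hG : WeakDeriv U i G G') :
    WeakDeriv U i (fun z => F z + G z) (fun z => F' z + G' z) := by
  refine ⟨hF.int.add hG.int, hF.int'.add hG.int', fun ψ hψ => ?_⟩
  simp only [add_mul]
  rw [integral_add ((hψ.sderiv i).integrable_mul hF.int) ((hψ.sderiv i).integrable_mul hG.int),
    integral_add (hψ.integrable_mul hF.int') (hψ.integrable_mul hG.int'), hF.eq ψ hψ, hG.eq ψ hψ]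
  ring

theorem WeakDeriv.sum {U : Set SpT} {i : Fin 3} {F F' : Fin 3 → SpT → ℝ}
    (hF : ∀ k, WeakDeriv U i (F k) (F' k)) :
    WeakDeriv U i (fun z => ∑ k, F k z) (fun z => ∑ k, F' k z) := by
  simp only [Fin.sum_univ_three]
  exact ((hF 0).add (hF 1)).add (hF 2)

theorem WeakDeriv.mul {U : Set SpT} (hU : IsOpen U) {v w v' w' : SpT → ℝ} {i : Fin 3}
    (mv : Measurable v) (mv' : Measurable v')
    (lv : MemLp v 2 (volume.restrict U)) (lw : MemLp w 2 (volume.restrict U))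
    (lv' : MemLp v' 2 (volume.restrict U)) (lw' : MemLp w' 2 (volume.restrict U))
    (hv : ∀ ψ, IsTestOn U ψ → ∫ z in U, v z * sderiv i ψ z = - ∫ z in U, v' z * ψ z)
    (hw : ∀ ψ, IsTestOn U ψ → ∫ z in U, w z * sderiv i ψ z = - ∫ z in U, w' z * ψ z) :
    WeakDeriv U i (fun z => v z * w z) (fun z => v' z * w z + v z * w' z) :=
  ⟨lv.integrable_mul lw, (lv'.integrable_mul lw).add (lv.integrable_mul lw'),
    fun _ hψ => weak_sderiv_mul hU mv mv' lv lw lv' lw' hv hw hψ⟩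

/-- The divergence of `u ⊗ u + ∇d ⊙ ∇d`. -/
def stressDiv (u : SpT → E3) (Du Dd : SpT → Fin 3 → Fin 3 → ℝ)
    (D2d : SpT → Fin 3 → Fin 3 → Fin 3 → ℝ) (j : Fin 3) (z : SpT) : ℝ :=
  ∑ i, ((Du z i i * u z j + u z i * Du z j i) +
    ∑ k, (D2d z k i i * Dd z k j + Dd z k i * D2d z k i j))

/-- The pressure equation after one integration by parts. -/
def PressureDivEqOn (U : Set SpT) (p : SpT → ℝ) (G : Fin 3 → SpT → ℝ) : Prop :=
  ∀ ψ, IsTestOn U ψ → ∫ z in U, p z * sLap ψ z = ∫ z in U, ∑ j, G j z * sderiv j ψ z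

theorem pressureDivEqOn_of_pressureEqOn {U : Set SpT} (hU : IsOpen U) {u : SpT → E3}
    {p : SpT → ℝ} {Du Dd : SpT → Fin 3 → Fin 3 → ℝ} {D2d : SpT → Fin 3 → Fin 3 → Fin 3 → ℝ}
    (mu : ∀ i, Measurable fun z => u z i) (mDu : ∀ i j, Measurable fun z => Du z i j)
    (mDd : ∀ i j, Measurable fun z => Dd z i j) (mD2d : ∀ i j k, Measurable fun z => D2d z i j k)
    (lu : ∀ i, MemLp (fun z => u z i) 2 (volume.restrict U))
    (lDu : ∀ i j, MemLp (fun z => Du z i j) 2 (volume.restrict U))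
    (lDd : ∀ i j, MemLp (fun z => Dd z i j) 2 (volume.restrict U))
    (lD2d : ∀ i j k, MemLp (fun z => D2d z i j k) 2 (volume.restrict U))
    (gu : ∀ i, WeakSGrad U (fun z => u z i) (fun j z => Du z i j))
    (gDd : ∀ i k, WeakSGrad U (fun z => Dd z i k) (fun j z => D2d z i j k))
    (hp : PressureEqOn U u p Dd) :
    (∀ j, IntegrableOn (stressDiv u Du Dd D2d j) U) ∧
      PressureDivEqOn U p (stressDiv u Du Dd D2d) := by
  have W : ∀ i j, WeakDeriv U i (fun z => u z i * u z j + ∑ k, Dd z k i * Dd z k j)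
      (fun z => (Du z i i * u z j + u z i * Du z j i) +
        ∑ k, (D2d z k i i * Dd z k j + Dd z k i * D2d z k i j)) := by
    intro i j
    refine WeakDeriv.add ?_ (WeakDeriv.sum fun k => ?_)
    · exact WeakDeriv.mul hU (mu i) (mDu i i) (lu i) (lu j) (lDu i i) (lDu j i)
        (gu i i) (gu j i)
    · exact WeakDeriv.mul hU (mDd k i) (mD2d k i i) (lDd k i) (lDd k j) (lD2d k i i)
        (lD2d k i j) (gDd k i i) (gDd k j i)
  have hint : ∀ j, IntegrableOn (stressDiv u Du Dd D2d j) U :=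
    fun j => integrable_finsetSum _ fun i _ => (W i j).int'
  refine ⟨hint, fun ψ hψ => ?_⟩
  have h1 := hp ψ hψ
  rw [integral_finsetSum _ fun i _ => integrable_finsetSum _ fun j _ =>
    ((hψ.sderiv j).sderiv i).integrable_mul (W i j).int] at h1
  rw [integral_finsetSum _ fun j _ => (hψ.sderiv j).integrable_mul (hint j)]
  have h2 : ∀ i, ∫ z in U, ∑ j, (u z i * u z j + ∑ k, Dd z k i * Dd z k j) *
      sderiv i (sderiv j ψ) z = ∑ j, -∫ z in U, ((Du z i i * u z j + u z i * Du z j i) +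
        ∑ k, (D2d z k i i * Dd z k j + Dd z k i * D2d z k i j)) * sderiv j ψ z := by
    intro i
    rw [integral_finsetSum _ fun j _ => ((hψ.sderiv j).sderiv i).integrable_mul (W i j).int]
    exact Finset.sum_congr rfl fun j _ => (W i j).eq _ (hψ.sderiv j)
  simp only [h2] at h1
  rw [Finset.sum_comm] at h1
  simp only [Finset.sum_neg_distrib] at h1
  rw [neg_inj] at h1
  rw [h1]
  refine Finset.sum_congr rfl fun j _ => ?_
  unfold stressDiv
  simp only [Finset.sum_mul]
  rw [integral_finsetSum _ fun i _ => (hψ.sderiv j).integrable_mul (W i j).int']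

theorem sderiv_mul_time {φ : E3 → ℝ} {χ : ℝ → ℝ} (hφ : Differentiable ℝ φ)
    (hχ : Differentiable ℝ χ) (j : Fin 3) :
    sderiv j (fun z => φ z.1 * χ z.2) = fun z => pderiv j φ z.1 * χ z.2 := by
  ext z
  have h1 : HasFDerivAt (fun z : SpT => φ z.1) ((fderiv ℝ φ z.1).comp
      (ContinuousLinearMap.fst ℝ E3 ℝ)) z := (hφ z.1).hasFDerivAt.comp z hasFDerivAt_fst
  have h2 : HasFDerivAt (fun z : SpT => χ z.2) ((fderiv ℝ χ z.2).comp
      (ContinuousLinearMap.snd ℝ E3 ℝ)) z := (hχ z.2).hasFDerivAt.comp z hasFDerivAt_snd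
  unfold sderiv pderiv
  rw [(h1.fun_mul h2).fderiv]
  simp
  ring

theorem isTestOn_mul_time {B : Set E3} {I : Set ℝ} {φ : E3 → ℝ} {χ : ℝ → ℝ}
    (hφ : ContDiff ℝ (⊤ : ℕ∞) φ) (hφc : HasCompactSupport φ) (hφs : tsupport φ ⊆ B)
    (hχ : ContDiff ℝ (⊤ : ℕ∞) χ) (hχc : HasCompactSupport χ) (hχs : tsupport χ ⊆ I) :
    IsTestOn (B ×ˢ I) (fun z => φ z.1 * χ z.2) := by
  have hts : tsupport (fun z : SpT => φ z.1 * χ z.2) ⊆ tsupport φ ×ˢ tsupport χ := by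
    refine closure_minimal ?_ ((isClosed_tsupport φ).prod (isClosed_tsupport χ))
    intro z hz
    have hz' : φ z.1 * χ z.2 ≠ 0 := hz
    exact ⟨subset_tsupport _ (left_ne_zero_of_mul hz'), subset_tsupport _
      (right_ne_zero_of_mul hz')⟩
  refine ⟨(hφ.comp contDiff_fst).mul (hχ.comp contDiff_snd), ?_, hts.trans (prod_mono hφs hχs)⟩
  exact HasCompactSupport.of_support_subset_isCompact (hφc.isCompact.prod hχc.isCompact)
    ((subset_tsupport _).trans hts)

/-- The time slices of a solution of the pressure equation solve the pressure equation. -/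
theorem ae_slice_pressure {B : Set E3} {I : Set ℝ} (hI : IsOpen I) {p : SpT → ℝ}
    {G : Fin 3 → SpT → ℝ} (hp : IntegrableOn p (B ×ˢ I)) (hG : ∀ j, IntegrableOn (G j) (B ×ˢ I))
    (h : PressureDivEqOn (B ×ˢ I) p G) {φ : E3 → ℝ}
    (hφ : ContDiff ℝ (⊤ : ℕ∞) φ) (hφc : HasCompactSupport φ) (hφs : tsupport φ ⊆ B) :
    ∀ᵐ t ∂(volume.restrict I), ∫ y in B, p (y, t) * ∑ j, pderiv j (pderiv j φ) y =
      ∫ y in B, ∑ j, G j (y, t) * pderiv j φ y := by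
  have hφd : Differentiable ℝ φ := hφ.differentiable (by simp)
  have hφd1 : ∀ j, Differentiable ℝ (pderiv j φ) :=
    fun j => (contDiff_pderiv hφ j).differentiable (by simp)
  have hvol : (volume : Measure SpT).restrict (B ×ˢ I) =
      (volume.restrict B).prod (volume.restrict I) := (Measure.prod_restrict B I).symm
  have hbdd : ∀ {f : SpT → ℝ} {g : E3 → ℝ}, IntegrableOn f (B ×ˢ I) → Continuous g →
      HasCompactSupport g → IntegrableOn (fun z => f z * g z.1) (B ×ˢ I) := by
    intro f g hf hg hgc
    obtain ⟨C, hC⟩ := hg.bounded_above_of_compact_support hgc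
    exact hf.mul_bdd (hg.comp continuous_fst).aestronglyMeasurable (ae_of_all _ fun z => hC z.1)
  have i1 : IntegrableOn (fun z => p z * ∑ j, pderiv j (pderiv j φ) z.1) (B ×ˢ I) := by
    simp only [Finset.mul_sum]
    exact integrable_finsetSum _ fun j _ => hbdd hp
      (contDiff_pderiv (contDiff_pderiv hφ j) j).continuous
      (hasCompactSupport_pderiv (hasCompactSupport_pderiv hφc j) j)
  have i2 : IntegrableOn (fun z => ∑ j, G j z * pderiv j φ z.1) (B ×ˢ I) :=
    integrable_finsetSum _ fun j _ => hbdd (hG j) (contDiff_pderiv hφ j).continuous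
      (hasCompactSupport_pderiv hφc j)
  rw [IntegrableOn, hvol] at i1 i2
  have i3 := i1.sub i2
  have hz := hI.ae_eq_zero_of_integral_contDiff_smul_eq_zero (μ := volume)
    (f := fun t => ∫ y in B, (p (y, t) * ∑ j, pderiv j (pderiv j φ) y
      - ∑ j, G j (y, t) * pderiv j φ y))
    (IntegrableOn.locallyIntegrableOn i3.integral_prod_right) ?_
  · rw [ae_restrict_iff' hI.measurableSet]
    have a1 := i1.prod_left_ae
    have a2 := i2.prod_left_ae
    rw [ae_restrict_iff' hI.measurableSet] at a1 a2
    filter_upwards [hz, a1, a2] with t ht b1 b2 htI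
    have := ht htI
    rwa [integral_sub (b1 htI) (b2 htI), sub_eq_zero] at this
  · intro χ hχ hχc hχs
    have hχd : Differentiable ℝ χ := hχ.differentiable (by simp)
    have htest := isTestOn_mul_time hφ hφc hφs hχ hχc hχs
    have h1 := h _ htest
    unfold sLap at h1
    simp only [sderiv_mul_time hφd hχd, sderiv_mul_time (hφd1 _) hχd] at h1
    obtain ⟨C, hC⟩ := hχ.continuous.bounded_above_of_compact_support hχc
    have hmul : ∀ {f : SpT → ℝ}, Integrable f ((volume.restrict B).prod (volume.restrict I)) →
        Integrable (fun z => f z * χ z.2) ((volume.restrict B).prod (volume.restrict I)) :=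
      fun hf => hf.mul_bdd (hχ.continuous.comp continuous_snd).aestronglyMeasurable
        (ae_of_all _ fun z => hC z.2)
    have e1 : ∫ t, χ t • ∫ y in B, (p (y, t) * ∑ j, pderiv j (pderiv j φ) y
        - ∑ j, G j (y, t) * pderiv j φ y) =
        ∫ t in I, ∫ y in B, ((p (y, t) * ∑ j, pderiv j (pderiv j φ) y
        - ∑ j, G j (y, t) * pderiv j φ y)) * χ t := by
      rw [← setIntegral_eq_integral_of_forall_compl_eq_zero (s := I)]
      · refine integral_congr_ae (ae_of_all _ fun t => ?_)
        dsimp only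
        rw [integral_mul_const, smul_eq_mul, mul_comm]
      · intro t ht
        rw [image_eq_zero_of_notMem_tsupport fun h => ht (hχs h), zero_smul]
    rw [e1, ← integral_prod_symm (fun z : SpT => ((p z * ∑ j, pderiv j (pderiv j φ) z.1
        - ∑ j, G j z * pderiv j φ z.1)) * χ z.2) (hmul i3)]
    simp only [sub_mul]
    rw [integral_sub (hmul i1) (hmul i2), ← hvol, sub_eq_zero]
    refine Eq.trans ?_ (h1.trans ?_)
    · refine integral_congr_ae (ae_of_all _ fun z => ?_)
      simp only [Finset.mul_sum, Finset.sum_mul, mul_assoc]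
    · refine integral_congr_ae (ae_of_all _ fun z => ?_)
      simp only [Finset.sum_mul, mul_assoc]

/-- The Riesz-type kernel `|y|^{-α}`, infinite at the origin. -/
def rieszK (α : ℝ) (y : E3) : ℝ≥0∞ := ‖y‖ₑ ^ (-α)

theorem measurable_rieszK (α : ℝ) : Measurable (rieszK α) := by
  unfold rieszK; fun_prop

theorem enorm_le_mul_rieszK_two {a c : ℝ} (hc : 0 < c) {y : E3} (h : |a| * ‖y‖ ^ 2 ≤ c) :
    ‖a‖ₑ ≤ ENNReal.ofReal c * rieszK 2 y := by
  unfold rieszK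
  rcases eq_or_ne y 0 with rfl | hy
  · rw [enorm_zero, ENNReal.zero_rpow_of_neg (by norm_num), ENNReal.mul_top (by simpa using hc)]
    exact le_top
  · have hy' : 0 < ‖y‖ := norm_pos_iff.2 hy
    rw [Real.enorm_eq_ofReal_abs, ← ofReal_norm, ENNReal.ofReal_rpow_of_pos hy',
      ← ENNReal.ofReal_mul hc.le]
    refine ENNReal.ofReal_le_ofReal ?_
    rw [Real.rpow_neg hy'.le, ← div_eq_mul_inv, le_div_iff₀ (by positivity)]
    simpa using h

section Cutoff

variable {K : ℝ} {x₀ : E3} {ρ : ℝ} {η : E3 → ℝ}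

theorem contDiff_regNewton {a : ℝ} (ha : 0 < a) (x : E3) : ContDiff ℝ (⊤ : ℕ∞) (regNewton a x) :=
  contDiff_rpow_norm_sq_add ha x _

theorem IsCutoff.pderiv_regNewton_le (hη : IsCutoff K x₀ ρ η) (hK : 0 ≤ K) (hρ : 0 < ρ) {a : ℝ}
    (ha : 0 < a) {x y : E3} (hx : x ∈ Metric.ball x₀ (ρ / 2)) (hy : y ∈ Metric.ball x₀ ρ)
    (j : Fin 3) :
    |pderiv j (fun y => η y * regNewton a x y) y| * ‖y - x‖ ^ 2 ≤ 1 + 2 * K := by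
  rw [pderiv_mul (hη.smooth.differentiable (by simp))
    ((contDiff_regNewton ha x).differentiable (by simp))]
  have h1 := pderiv_regNewton_mul_norm_le ha x y j
  have h2 := regNewton_mul_norm_le ha x y
  have h3 := hη.abs_le y
  have h4 := hη.pderiv_le j y
  have hxy : ‖y - x‖ ≤ 2 * ρ := by
    rw [← dist_eq_norm]
    have := dist_triangle_right y x x₀
    have := Metric.mem_ball.1 hx
    have := Metric.mem_ball.1 hy
    linarith
  calc |η y * pderiv j (regNewton a x) y + regNewton a x y * pderiv j η y| * ‖y - x‖ ^ 2
      ≤ (|η y| * |pderiv j (regNewton a x) y| + |regNewton a x y| * |pderiv j η y|)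
          * ‖y - x‖ ^ 2 := by
        gcongr
        rw [← abs_mul, ← abs_mul]
        exact abs_add_le _ _
    _ = |η y| * (|pderiv j (regNewton a x) y| * ‖y - x‖ ^ 2) +
        (|regNewton a x y| * ‖y - x‖) * (|pderiv j η y| * ‖y - x‖) := by ring
    _ ≤ 1 * 1 + 1 * (K / ρ * (2 * ρ)) := by gcongr
    _ = 1 + 2 * K := by field_simp

theorem IsCutoff.error_le (hη : IsCutoff K x₀ ρ η) (hK : 0 ≤ K) (hρ : 0 < ρ) {a : ℝ}
    (ha : 0 < a) {x y : E3} (hx : x ∈ Metric.ball x₀ (ρ / 2)) :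
    |(∑ j, pderiv j (pderiv j (fun y => η y * regNewton a x y)) y) + η y * regKernel a (y - x)| ≤
      108 * K / ρ ^ 3 := by
  simp only [pderiv_pderiv_mul hη.smooth (contDiff_regNewton ha x)]
  rw [Finset.sum_add_distrib, Finset.sum_add_distrib, ← Finset.mul_sum,
    sum_pderiv_pderiv_regNewton ha]
  have e : η y * -regKernel a (y - x) +
      ∑ j, 2 * (pderiv j η y * pderiv j (regNewton a x) y) +
      ∑ j, regNewton a x y * pderiv j (pderiv j η) y + η y * regKernel a (y - x) =
      ∑ j, (2 * (pderiv j η y * pderiv j (regNewton a x) y) +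
        regNewton a x y * pderiv j (pderiv j η) y) := by
    rw [Finset.sum_add_distrib]
    ring
  rw [e]
  have hj : ∀ j, |2 * (pderiv j η y * pderiv j (regNewton a x) y) +
      regNewton a x y * pderiv j (pderiv j η) y| ≤ 36 * K / ρ ^ 3 := by
    intro j
    by_cases hy : y ∈ Metric.ball x₀ (3 / 4 * ρ)
    · rw [hη.pderiv_eq j y hy, hη.pderiv2_eq j y hy]
      simp
      positivity
    · have hxy : ρ / 4 ≤ ‖y - x‖ := by
        rw [← dist_eq_norm]
        have := dist_triangle y x x₀
        have := Metric.mem_ball.1 hx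
        rw [Metric.mem_ball, not_lt] at hy
        linarith
      have hpos : 0 < ‖y - x‖ := lt_of_lt_of_le (by positivity) hxy
      have h1 : |pderiv j (regNewton a x) y| ≤ 16 / ρ ^ 2 := by
        rw [le_div_iff₀ (by positivity)]
        have := pderiv_regNewton_mul_norm_le ha x y j
        have h5 : ρ ^ 2 ≤ 16 * ‖y - x‖ ^ 2 := by nlinarith
        calc _ ≤ |pderiv j (regNewton a x) y| * (16 * ‖y - x‖ ^ 2) := by gcongr
          _ ≤ 16 := by linarith
      have h2 : |regNewton a x y| ≤ 4 / ρ := by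
        rw [le_div_iff₀ (by positivity)]
        have := regNewton_mul_norm_le ha x y
        calc _ ≤ |regNewton a x y| * (4 * ‖y - x‖) := by gcongr; linarith
          _ ≤ 4 := by linarith
      calc _ ≤ 2 * (|pderiv j η y| * |pderiv j (regNewton a x) y|) +
            |regNewton a x y| * |pderiv j (pderiv j η) y| := by
            refine (abs_add_le _ _).trans (le_of_eq ?_)
            rw [abs_mul, abs_mul, abs_mul]
            norm_num
        _ ≤ 2 * (K / ρ * (16 / ρ ^ 2)) + 4 / ρ * (K / ρ ^ 2) := by
            gcongr
            · exact hη.pderiv_le j y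
            · exact hη.pderiv2_le j y
        _ = 36 * K / ρ ^ 3 := by field_simp; norm_num
  calc _ ≤ ∑ j : Fin 3, 36 * K / ρ ^ 3 :=
        (Finset.abs_sum_le_sum_abs _ _).trans (Finset.sum_le_sum fun j _ => hj j)
    _ = 108 * K / ρ ^ 3 := by simp; ring

/-- A solution of a slice of the pressure equation, averaged against the regularised kernel. -/
theorem IsCutoff.enorm_integral_regKernel_le (hη : IsCutoff K x₀ ρ η) (hK : 0 ≤ K) (hρ : 0 < ρ)
    {a : ℝ} (ha : 0 < a) {x : E3} (hx : x ∈ Metric.ball x₀ (ρ / 2)) {q : E3 → ℝ}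
    {H : Fin 3 → E3 → ℝ} {g : E3 → ℝ≥0∞} (hg : ∀ j y, ‖H j y‖ₑ ≤ g y)
    (hq : IntegrableOn q (Metric.ball x₀ ρ))
    (h : ∫ y in Metric.ball x₀ ρ, q y *
        ∑ j, pderiv j (pderiv j (fun y => η y * regNewton a x y)) y =
      ∫ y in Metric.ball x₀ ρ, ∑ j, H j y * pderiv j (fun y => η y * regNewton a x y) y) :
    ‖∫ y, regKernel a y * (q (x - y) * η (x - y))‖ₑ ≤
      ENNReal.ofReal (108 * K + 3 * (1 + 2 * K)) *
      (ENNReal.ofReal (ρ ^ 3)⁻¹ * (∫⁻ y in Metric.ball x₀ ρ, ‖q y‖ₑ) +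
        ∫⁻ y in Metric.ball x₀ ρ, rieszK 2 (y - x) * g y) := by
  set Bρ := Metric.ball x₀ ρ with hB
  have hBm : MeasurableSet Bρ := Metric.isOpen_ball.measurableSet
  set φ : E3 → ℝ := fun y => η y * regNewton a x y with hφ
  have hφs : ContDiff ℝ (⊤ : ℕ∞) φ := hη.smooth.mul (contDiff_regNewton ha x)
  have hφc : HasCompactSupport φ := hη.compact.mul_right
  have hkeven : ∀ y, regKernel a (x - y) = regKernel a (y - x) := by
    intro y; unfold regKernel; rw [norm_sub_rev]
  have e1 : ∫ y, regKernel a y * (q (x - y) * η (x - y)) =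
      ∫ y in Bρ, q y * (η y * regKernel a (y - x)) := by
    rw [← integral_sub_left_eq_self _ volume x, ← setIntegral_eq_integral_of_forall_compl_eq_zero
      (s := Bρ)]
    · refine integral_congr_ae (ae_of_all _ fun y => ?_)
      dsimp only
      rw [sub_sub_cancel, hkeven]
      ring
    · intro y hy
      have : η y = 0 := image_eq_zero_of_notMem_tsupport fun h => hy (hη.supp h)
      simp [this]
  have hcont1 : Continuous fun y => ∑ j, pderiv j (pderiv j φ) y :=
    continuous_finsetSum _ fun j _ => (contDiff_pderiv (contDiff_pderiv hφs j) j).continuous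
  have hcont2 : Continuous fun y => η y * regKernel a (y - x) := by
    have : ∀ y, regKernel a (y - x) = -∑ j, pderiv j (pderiv j (regNewton a x)) y := by
      intro y; rw [sum_pderiv_pderiv_regNewton ha, neg_neg]
    simp only [this]
    exact hη.smooth.continuous.mul (continuous_finsetSum _ fun j _ =>
      (contDiff_pderiv (contDiff_pderiv (contDiff_regNewton ha x) j) j).continuous).neg
  have hint : ∀ {f : E3 → ℝ}, Continuous f → IntegrableOn (fun y => q y * f y) Bρ := by
    intro f hf
    obtain ⟨C, hC⟩ := (isCompact_closedBall x₀ ρ).exists_bound_of_continuousOn hf.continuousOn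
    refine hq.mul_bdd (c := C) hf.aestronglyMeasurable ?_
    rw [ae_restrict_iff' hBm]
    exact ae_of_all _ fun y hy => hC y (Metric.ball_subset_closedBall hy)
  have e2 : ∫ y in Bρ, q y * (η y * regKernel a (y - x)) =
      (∫ y in Bρ, q y * ((∑ j, pderiv j (pderiv j φ) y) + η y * regKernel a (y - x))) -
        ∫ y in Bρ, ∑ j, H j y * pderiv j φ y := by
    rw [← h]
    simp only [mul_add]
    rw [integral_add (hint hcont1) (hint hcont2)]
    ring
  rw [e1, e2]
  refine enorm_sub_le.trans ?_
  have b1 : ‖∫ y in Bρ, q y * ((∑ j, pderiv j (pderiv j φ) y) + η y * regKernel a (y - x))‖ₑ ≤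
      ENNReal.ofReal (108 * K) * (ENNReal.ofReal (ρ ^ 3)⁻¹ * (∫⁻ y in Bρ, ‖q y‖ₑ)) := by
    refine (enorm_integral_le_lintegral_enorm _).trans ?_
    rw [← mul_assoc, ← ENNReal.ofReal_mul (by positivity), ← div_eq_mul_inv,
      ← lintegral_const_mul' _ _ ENNReal.ofReal_ne_top]
    refine lintegral_mono fun y => ?_
    rw [enorm_mul, mul_comm]
    gcongr
    rw [Real.enorm_eq_ofReal_abs]
    exact ENNReal.ofReal_le_ofReal (hη.error_le hK hρ ha hx)
  have b2 : ‖∫ y in Bρ, ∑ j, H j y * pderiv j φ y‖ₑ ≤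
      ENNReal.ofReal (3 * (1 + 2 * K)) * ∫⁻ y in Bρ, rieszK 2 (y - x) * g y := by
    refine (enorm_integral_le_lintegral_enorm _).trans ?_
    rw [← lintegral_const_mul' _ _ ENNReal.ofReal_ne_top]
    refine setLIntegral_mono' hBm fun y hy => ?_
    calc ‖∑ j, H j y * pderiv j φ y‖ₑ ≤ ∑ j, ‖H j y * pderiv j φ y‖ₑ := enorm_sum_le _ _
      _ ≤ ∑ j : Fin 3, ENNReal.ofReal (1 + 2 * K) * (rieszK 2 (y - x) * g y) := by
        refine Finset.sum_le_sum fun j _ => ?_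
        rw [enorm_mul, mul_comm, ← mul_assoc]
        gcongr
        · exact enorm_le_mul_rieszK_two (by positivity) (hη.pderiv_regNewton_le hK hρ ha hx hy j)
        · exact hg j y
      _ = _ := by
        rw [Finset.sum_const, Finset.card_univ, Fintype.card_fin, nsmul_eq_mul, ← mul_assoc,
          ENNReal.ofReal_mul (by norm_num)]
        norm_num
  calc _ ≤ _ := add_le_add b1 b2
    _ ≤ ENNReal.ofReal (108 * K + 3 * (1 + 2 * K)) * (ENNReal.ofReal (ρ ^ 3)⁻¹ *
          (∫⁻ y in Bρ, ‖q y‖ₑ)) + ENNReal.ofReal (108 * K + 3 * (1 + 2 * K)) *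
          ∫⁻ y in Bρ, rieszK 2 (y - x) * g y := by
        gcongr
        · linarith
        · linarith
    _ = _ := (mul_add _ _ _).symm

end Cutoff

/-- Pointwise control of the pressure by its mean and a Riesz potential of the right-hand side. -/
theorem exists_ae_ae_enorm_pressure_le : ∃ c : ℝ≥0, ∀ (x₀ : E3) (ρ : ℝ) (I : Set ℝ), 0 < ρ →
    IsOpen I → ∀ (p : SpT → ℝ) (G : Fin 3 → SpT → ℝ) (g : SpT → ℝ≥0∞), Measurable p →
    Measurable g → (∀ j z, ‖G j z‖ₑ ≤ g z) →
    IntegrableOn p (Metric.ball x₀ ρ ×ˢ I) → (∀ j, IntegrableOn (G j) (Metric.ball x₀ ρ ×ˢ I)) →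
    PressureDivEqOn (Metric.ball x₀ ρ ×ˢ I) p G →
    ∀ᵐ t ∂(volume.restrict I), ∀ᵐ x ∂(volume.restrict (Metric.ball x₀ (ρ / 2))),
      ‖p (x, t)‖ₑ ≤ c * (ENNReal.ofReal (ρ ^ 3)⁻¹ * (∫⁻ y in Metric.ball x₀ ρ, ‖p (y, t)‖ₑ) +
        ∫⁻ y in Metric.ball x₀ ρ, rieszK 2 (y - x) * g (y, t)) := by
  obtain ⟨K, hK, hcut⟩ := exists_isCutoff
  refine ⟨(regMass⁻¹).toNNReal * (108 * K + 3 * (1 + 2 * K)).toNNReal, ?_⟩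
  intro x₀ ρ I hρ hI p G g hp hg hGg hpi hGi hpG
  obtain ⟨η, hη⟩ := hcut x₀ ρ hρ
  have hηm : Measurable η := hη.smooth.continuous.measurable
  have hpi' := hpi
  rw [IntegrableOn, Measure.volume_eq_prod, ← Measure.prod_restrict] at hpi'
  have hpt := hpi'.prod_left_ae
  set M : E3 → ℝ → ℝ≥0∞ := fun x t => ENNReal.ofReal (108 * K + 3 * (1 + 2 * K)) *
      (ENNReal.ofReal (ρ ^ 3)⁻¹ * (∫⁻ y in Metric.ball x₀ ρ, ‖p (y, t)‖ₑ) +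
        ∫⁻ y in Metric.ball x₀ ρ, rieszK 2 (y - x) * g (y, t)) with hM
  have hMm : Measurable fun q : E3 × ℝ => M q.1 q.2 := by
    refine Measurable.const_mul (Measurable.add (Measurable.const_mul ?_ _) ?_) _
    · exact Measurable.lintegral_prod_right' (f := fun q : (E3 × ℝ) × E3 => ‖p (q.2, q.1.2)‖ₑ)
        (by fun_prop)
    · refine Measurable.lintegral_prod_right' (f := fun q : (E3 × ℝ) × E3 =>
        rieszK 2 (q.2 - q.1.1) * g (q.2, q.1.2)) ?_
      exact ((measurable_rieszK 2).comp (by fun_prop)).mul (hg.comp (by fun_prop))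
  have hkey : ∀ n : ℕ, ∀ᵐ t ∂(volume.restrict I), ∀ᵐ x ∂(volume.restrict (Metric.ball x₀ (ρ / 2))),
      ‖∫ y, regKernel (1 / (n + 1)) y * (p (x - y, t) * η (x - y))‖ₑ ≤ M x t := by
    intro n
    have ha : (0 : ℝ) < 1 / (n + 1) := by positivity
    rw [← Measure.ae_ae_comm (p := fun x t =>
      ‖∫ y, regKernel (1 / (n + 1)) y * (p (x - y, t) * η (x - y))‖ₑ ≤ M x t)]
    · rw [ae_restrict_iff' Metric.isOpen_ball.measurableSet]
      refine ae_of_all _ fun x hx => ?_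
      have hs := ae_slice_pressure hI hpi hGi hpG
        (φ := fun y => η y * regNewton (1 / (n + 1)) x y)
        (hη.smooth.mul (contDiff_regNewton ha x)) hη.compact.mul_right
        ((tsupport_mul_subset_left).trans hη.supp)
      filter_upwards [hs, hpt] with t ht1 ht2
      exact hη.enorm_integral_regKernel_le hK hρ ha hx (q := fun y => p (y, t))
        (H := fun j y => G j (y, t)) (fun j y => hGg j (y, t)) ht2 ht1
    · refine measurableSet_le ?_ hMm
      refine Measurable.enorm ?_
      refine StronglyMeasurable.measurable ?_
      refine StronglyMeasurable.integral_prod_right' (f := fun q : (E3 × ℝ) × E3 =>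
        regKernel (1 / (n + 1)) q.2 * (p (q.1.1 - q.2, q.1.2) * η (q.1.1 - q.2))) ?_
      refine Measurable.stronglyMeasurable ?_
      exact ((measurable_regKernel _).comp measurable_snd).mul
        ((hp.comp (by fun_prop)).mul (hηm.comp (by fun_prop)))
  filter_upwards [ae_all_iff.2 hkey, hpt] with t ht1 ht2
  have hfm : Measurable fun y => p (y, t) * η y := (hp.comp (by fun_prop)).mul hηm
  have hfi : Integrable fun y => p (y, t) * η y := by
    have h1 : IntegrableOn (fun y => p (y, t) * η y) (Metric.ball x₀ ρ) :=
      ht2.mul_bdd (c := 1) hηm.aestronglyMeasurable (ae_of_all _ hη.abs_le)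
    refine (integrableOn_iff_integrable_of_support_subset ?_).1 h1
    intro y hy
    exact hη.supp (subset_tsupport _ (right_ne_zero_of_mul hy))
  have hfin := ae_enorm_le_of_regKernel_le hfm hfi (M := fun x => M x t)
    (hMm.comp (by fun_prop : Measurable fun x : E3 => (x, t))) ht1
  rw [ae_restrict_iff' Metric.isOpen_ball.measurableSet] at hfin ⊢
  filter_upwards [hfin] with x hx hxB
  have h2 := hx hxB
  rw [hη.eq_one x hxB, mul_one] at h2
  refine h2.trans (le_of_eq ?_)
  rw [hM, ENNReal.coe_mul, mul_assoc]
  rfl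

theorem rieszK_eq_inv_rpow (α : ℝ) (y : E3) : rieszK α y = (‖y‖ₑ⁻¹) ^ α := by
  rw [rieszK, ENNReal.rpow_neg, ENNReal.inv_rpow]

theorem rieszK_rpow (α s : ℝ) (y : E3) : rieszK α y ^ s = rieszK (α * s) y := by
  simp only [rieszK_eq_inv_rpow, ENNReal.rpow_mul]

theorem rieszK_add {α β : ℝ} (hα : 0 ≤ α) (hβ : 0 ≤ β) (y : E3) :
    rieszK (α + β) y = rieszK α y * rieszK β y := by
  simp only [rieszK_eq_inv_rpow, ENNReal.rpow_add_of_nonneg _ _ hα hβ]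

theorem rieszK_sub_comm (α : ℝ) (x y : E3) : rieszK α (x - y) = rieszK α (y - x) := by
  rw [rieszK, rieszK, enorm_sub_rev]

theorem rieszK_smul {α ρ : ℝ} (hρ : 0 < ρ) (y : E3) :
    rieszK α (ρ • y) = ENNReal.ofReal (ρ ^ (-α)) * rieszK α y := by
  unfold rieszK
  rw [enorm_smul, ENNReal.mul_rpow_of_ne_top (by simp) (by simp), Real.enorm_eq_ofReal hρ.le,
    ENNReal.ofReal_rpow_of_pos hρ]

theorem lintegral_ball_rieszK_lt_top {α : ℝ} (hα : α < 3) :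
    ∫⁻ y in Metric.ball (0 : E3) 2, rieszK α y < ∞ := by
  have h : IntegrableOn (fun y : E3 => ‖y‖ ^ (-α)) (Metric.ball 0 2) := by
    refine (integrableOn_fun_norm_addHaar (volume : Measure E3) (f := fun r => r ^ (-α))).2 ?_
    have h1 := (intervalIntegral.integrableOn_Ioo_rpow_iff (s := 2 - α) (t := 2) (by norm_num)).2
      (by linarith)
    refine h1.congr_fun (fun r hr => ?_) measurableSet_Ioo
    have hr0 : 0 < r := hr.1
    simp only [finrank_euclideanSpace, Fintype.card_fin, smul_eq_mul]
    rw [sub_eq_add_neg, Real.rpow_add hr0]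
    norm_num
  refine lt_of_le_of_lt (le_of_eq ?_) h.2
  refine lintegral_congr_ae (ae_restrict_of_ae ?_)
  filter_upwards [Measure.ae_ne volume (0 : E3)] with y hy
  rw [rieszK, ← ofReal_norm, ENNReal.ofReal_rpow_of_pos (norm_pos_iff.2 hy),
    Real.enorm_of_nonneg (by positivity)]

/-- The Riesz kernel integrated over a ball. -/
theorem exists_lintegral_rieszK_le {α : ℝ} (hα : α < 3) : ∃ c : ℝ≥0, ∀ (x₀ : E3) (ρ : ℝ), 0 < ρ →
    ∀ x ∈ Metric.ball x₀ ρ, ∫⁻ y in Metric.ball x₀ ρ, rieszK α (y - x) ≤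
      c * ENNReal.ofReal (ρ ^ (3 - α)) := by
  refine ⟨(∫⁻ y in Metric.ball (0 : E3) 2, rieszK α y).toNNReal, fun x₀ ρ hρ x hx => ?_⟩
  rw [ENNReal.coe_toNNReal (lintegral_ball_rieszK_lt_top hα).ne]
  have h1 : ∫⁻ y in Metric.ball x₀ ρ, rieszK α (y - x) ≤
      ∫⁻ y, (Metric.ball (0 : E3) (2 * ρ)).indicator (rieszK α) (y - x) := by
    rw [← lintegral_indicator Metric.isOpen_ball.measurableSet]
    refine lintegral_mono fun y => ?_
    by_cases hy : y ∈ Metric.ball x₀ ρ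
    · have : y - x ∈ Metric.ball (0 : E3) (2 * ρ) := by
        rw [mem_ball_zero_iff, ← dist_eq_norm]
        have := dist_triangle_right y x x₀
        have := Metric.mem_ball.1 hx
        have := Metric.mem_ball.1 hy
        linarith
      simp [hy, this]
    · simp [hy]
  refine h1.trans ?_
  rw [lintegral_sub_right_eq_self (fun y => (Metric.ball (0 : E3) (2 * ρ)).indicator
    (rieszK α) y) x]
  have h2 := lintegral_comp_smul_E3 hρ
    (fun y => (Metric.ball (0 : E3) (2 * ρ)).indicator (rieszK α) y)
  have h3 : ∀ y : E3, (Metric.ball (0 : E3) (2 * ρ)).indicator (rieszK α) (ρ • y) =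
      ENNReal.ofReal (ρ ^ (-α)) * (Metric.ball (0 : E3) 2).indicator (rieszK α) y := by
    intro y
    have : ρ • y ∈ Metric.ball (0 : E3) (2 * ρ) ↔ y ∈ Metric.ball (0 : E3) 2 := by
      rw [mem_ball_zero_iff, mem_ball_zero_iff, norm_smul, Real.norm_of_nonneg hρ.le, mul_comm 2,
        mul_lt_mul_iff_right₀ hρ]
    by_cases hy : y ∈ Metric.ball (0 : E3) 2
    · rw [indicator_of_mem (this.2 hy), indicator_of_mem hy, rieszK_smul hρ]
    · rw [indicator_of_notMem (mt this.1 hy), indicator_of_notMem hy, mul_zero]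
  simp only [h3] at h2
  rw [lintegral_const_mul' _ _ ENNReal.ofReal_ne_top,
    lintegral_indicator Metric.isOpen_ball.measurableSet] at h2
  have h4 : ENNReal.ofReal (ρ ^ 3) * ENNReal.ofReal (ρ ^ 3)⁻¹ = 1 := by
    rw [← ENNReal.ofReal_mul (by positivity), mul_inv_cancel₀ (by positivity), ENNReal.ofReal_one]
  calc ∫⁻ y, (Metric.ball (0 : E3) (2 * ρ)).indicator (rieszK α) y
      = ENNReal.ofReal (ρ ^ 3) * (ENNReal.ofReal (ρ ^ 3)⁻¹ *
          ∫⁻ y, (Metric.ball (0 : E3) (2 * ρ)).indicator (rieszK α) y) := by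
        rw [← mul_assoc, h4, one_mul]
    _ = (∫⁻ y in Metric.ball (0 : E3) 2, rieszK α y) * ENNReal.ofReal (ρ ^ (3 - α)) := by
        rw [← h2, ← mul_assoc, ← ENNReal.ofReal_mul (by positivity), mul_comm]
        congr 2
        rw [← Real.rpow_natCast, ← Real.rpow_add hρ]
        norm_num
        rfl
    _ ≤ _ := le_rfl

theorem lintegral_rieszK_mul_le {μ : Measure E3} {v w : E3 → ℝ≥0∞} (hv : Measurable v)
    (hw : Measurable w) (x : E3) :
    (∫⁻ y, rieszK 2 (y - x) * (v y * w y) ∂μ) ^ (3 / 2 : ℝ) ≤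
      ((∫⁻ y, v y ^ (2 : ℝ) ∂μ) ^ (3 / 8 : ℝ) *
        (∫⁻ y, rieszK (5 / 2) (y - x) ∂μ) ^ (1 / 8 : ℝ)) *
      ((∫⁻ y, rieszK (11 / 4) (y - x) * w y ^ (2 : ℝ) ∂μ) ^ (3 / 4 : ℝ) *
        (∫⁻ y, rieszK (5 / 2) (y - x) * v y ^ (3 : ℝ) ∂μ) ^ (1 / 4 : ℝ)) := by
  have hK : ∀ α, Measurable fun y => rieszK α (y - x) :=
    fun α => (measurable_rieszK α).comp (by fun_prop)
  have hv2 : Measurable fun y => v y ^ (2 : ℝ) := by fun_prop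
  have hw2 : Measurable fun y => w y ^ (2 : ℝ) := by fun_prop
  have hv3 : Measurable fun y => v y ^ (3 : ℝ) := by fun_prop
  set V := ∫⁻ y, v y ^ (2 : ℝ) ∂μ
  set R := ∫⁻ y, rieszK (5 / 2) (y - x) ∂μ
  set W := ∫⁻ y, rieszK (11 / 4) (y - x) * w y ^ (2 : ℝ) ∂μ
  set P := ∫⁻ y, rieszK (5 / 2) (y - x) * v y ^ (3 : ℝ) ∂μ
  have h1 : ∫⁻ y, rieszK 2 (y - x) * (v y * w y) ∂μ ≤
      W ^ (1 / 2 : ℝ) * (∫⁻ y, rieszK (5 / 4) (y - x) * v y ^ (2 : ℝ) ∂μ) ^ (1 / 2 : ℝ) := by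
    refine le_trans (le_of_eq ?_) (ENNReal.lintegral_mul_norm_pow_le
      ((hK (11 / 4)).mul hw2).aemeasurable ((hK (5 / 4)).mul hv2).aemeasurable
      (by norm_num) (by norm_num) (by norm_num))
    refine lintegral_congr fun y => ?_
    dsimp only [Pi.mul_apply]
    rw [ENNReal.mul_rpow_of_nonneg _ _ (by norm_num), ENNReal.mul_rpow_of_nonneg _ _ (by norm_num),
      rieszK_rpow, rieszK_rpow, ← ENNReal.rpow_mul, ← ENNReal.rpow_mul]
    rw [show (2 : ℝ) = 11 / 4 * (1 / 2) + 5 / 4 * (1 / 2) by norm_num,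
      rieszK_add (by norm_num) (by norm_num)]
    norm_num
    ring
  have h2 : ∫⁻ y, rieszK (5 / 4) (y - x) * v y ^ (2 : ℝ) ∂μ ≤
      V ^ (1 / 2 : ℝ) * (∫⁻ y, rieszK (5 / 2) (y - x) * v y ^ (2 : ℝ) ∂μ) ^ (1 / 2 : ℝ) := by
    refine le_trans (le_of_eq ?_) (ENNReal.lintegral_mul_norm_pow_le
      hv2.aemeasurable ((hK (5 / 2)).mul hv2).aemeasurable
      (by norm_num) (by norm_num) (by norm_num))
    refine lintegral_congr fun y => ?_
    dsimp only [Pi.mul_apply]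
    rw [ENNReal.mul_rpow_of_nonneg _ _ (by norm_num), rieszK_rpow, ← ENNReal.rpow_mul]
    rw [show v y ^ (2 : ℝ) = v y ^ (2 * (1 / 2) : ℝ) * v y ^ (2 * (1 / 2) : ℝ) by
      rw [← ENNReal.rpow_add_of_nonneg _ _ (by norm_num) (by norm_num)]; norm_num]
    norm_num
    ring
  have h3 : ∫⁻ y, rieszK (5 / 2) (y - x) * v y ^ (2 : ℝ) ∂μ ≤
      P ^ (2 / 3 : ℝ) * R ^ (1 / 3 : ℝ) := by
    refine le_trans (le_of_eq ?_) (ENNReal.lintegral_mul_norm_pow_le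
      ((hK (5 / 2)).mul hv3).aemeasurable (hK (5 / 2)).aemeasurable
      (by norm_num) (by norm_num) (by norm_num))
    refine lintegral_congr fun y => ?_
    dsimp only [Pi.mul_apply]
    rw [ENNReal.mul_rpow_of_nonneg _ _ (by norm_num), rieszK_rpow, rieszK_rpow, ← ENNReal.rpow_mul]
    rw [show (5 / 2 : ℝ) = 5 / 2 * (2 / 3) + 5 / 2 * (1 / 3) by norm_num,
      rieszK_add (by norm_num) (by norm_num)]
    norm_num
    ring
  have h4 : ∫⁻ y, rieszK 2 (y - x) * (v y * w y) ∂μ ≤ W ^ (1 / 2 : ℝ) *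
      (V ^ (1 / 2 : ℝ) * (P ^ (2 / 3 : ℝ) * R ^ (1 / 3 : ℝ)) ^ (1 / 2 : ℝ)) ^ (1 / 2 : ℝ) := by
    refine h1.trans ?_
    gcongr
    refine h2.trans ?_
    gcongr
  refine (ENNReal.rpow_le_rpow h4 (by norm_num)).trans (le_of_eq ?_)
  simp only [ENNReal.mul_rpow_of_nonneg _ _ (by norm_num : (0 : ℝ) ≤ 1 / 2),
    ENNReal.mul_rpow_of_nonneg _ _ (by norm_num : (0 : ℝ) ≤ 3 / 2), ← ENNReal.rpow_mul]
  norm_num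
  ring

theorem lintegral_lintegral_rieszK_le {α : ℝ} {μ : Measure E3} {ν : Measure ℝ} [SFinite μ]
    [SFinite ν] {κ : ℝ≥0∞} (hκ : ∀ᵐ y ∂μ, ∫⁻ x, rieszK α (x - y) ∂μ ≤ κ) {f : SpT → ℝ≥0∞}
    (hf : Measurable f) :
    ∫⁻ q, ∫⁻ y, rieszK α (y - q.1) * f (y, q.2) ∂μ ∂(μ.prod ν) ≤ κ * ∫⁻ q, f q ∂(μ.prod ν) := by
  have hm : Measurable fun q : (E3 × ℝ) × E3 => rieszK α (q.2 - q.1.1) * f (q.2, q.1.2) :=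
    ((measurable_rieszK α).comp (by fun_prop)).mul (hf.comp (by fun_prop))
  rw [lintegral_prod_symm' _ hm.lintegral_prod_right', lintegral_prod_symm' _ hf,
    ← lintegral_const_mul _ (hf.lintegral_prod_left')]
  refine lintegral_mono fun t => ?_
  have hft : Measurable fun x => f (x, t) := hf.comp (by fun_prop)
  rw [lintegral_lintegral_swap, ← lintegral_const_mul _ hft]
  · refine lintegral_mono_ae ?_
    filter_upwards [hκ] with y hy
    simp only [rieszK_sub_comm α y]
    have hKm : Measurable fun x => rieszK α (x - y) := (measurable_rieszK α).comp (by fun_prop)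
    rw [lintegral_mul_const _ hKm]
    gcongr
  · exact (hm.comp (by fun_prop : Measurable fun q : E3 × E3 => ((q.1, t), q.2))).aemeasurable

/-- Space-time estimate for the Riesz potential of `v * w`. -/
theorem exists_lintegral_rieszK_rpow_le : ∃ c : ℝ≥0, ∀ (x₀ : E3) (ρ : ℝ) (I : Set ℝ), 0 < ρ →
    ∀ (v w : SpT → ℝ≥0∞) (V : ℝ≥0∞), Measurable v → Measurable w →
    (∀ᵐ t ∂(volume.restrict I), ∫⁻ y in Metric.ball x₀ ρ, v (y, t) ^ (2 : ℝ) ≤ V) →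
    ∫⁻ q in Metric.ball x₀ ρ ×ˢ I, (∫⁻ y in Metric.ball x₀ ρ,
        rieszK 2 (y - q.1) * (v (y, q.2) * w (y, q.2))) ^ (3 / 2 : ℝ) ≤
      c * ENNReal.ofReal (ρ ^ (3 / 8 : ℝ)) * (V ^ (3 / 8 : ℝ) *
        (∫⁻ q in Metric.ball x₀ ρ ×ˢ I, w q ^ (2 : ℝ)) ^ (3 / 4 : ℝ) *
        (∫⁻ q in Metric.ball x₀ ρ ×ˢ I, v q ^ (3 : ℝ)) ^ (1 / 4 : ℝ)) := by
  obtain ⟨c1, hc1⟩ := exists_lintegral_rieszK_le (α := 5 / 2) (by norm_num)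
  obtain ⟨c2, hc2⟩ := exists_lintegral_rieszK_le (α := 11 / 4) (by norm_num)
  refine ⟨c1 ^ (1 / 8 : ℝ) * c2 ^ (3 / 4 : ℝ) * c1 ^ (1 / 4 : ℝ), ?_⟩
  intro x₀ ρ I hρ v w V hv hw hV
  set μ := (volume : Measure E3).restrict (Metric.ball x₀ ρ) with hμ
  set ν := (volume : Measure ℝ).restrict I with hν
  have hvol : (volume : Measure SpT).restrict (Metric.ball x₀ ρ ×ˢ I) = μ.prod ν :=
    (Measure.prod_restrict _ I).symm
  rw [hvol]
  set κ1 := c1 * ENNReal.ofReal (ρ ^ (1 / 2 : ℝ)) with hκ1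
  set κ2 := c2 * ENNReal.ofReal (ρ ^ (1 / 4 : ℝ)) with hκ2
  have k1 : ∀ᵐ x ∂μ, ∫⁻ y, rieszK (5 / 2) (y - x) ∂μ ≤ κ1 := by
    rw [hμ, ae_restrict_iff' Metric.isOpen_ball.measurableSet]
    refine ae_of_all _ fun x hx => (hc1 x₀ ρ hρ x hx).trans (le_of_eq ?_)
    norm_num [hκ1]
  have k2 : ∀ᵐ x ∂μ, ∫⁻ y, rieszK (11 / 4) (y - x) ∂μ ≤ κ2 := by
    rw [hμ, ae_restrict_iff' Metric.isOpen_ball.measurableSet]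
    refine ae_of_all _ fun x hx => (hc2 x₀ ρ hρ x hx).trans (le_of_eq ?_)
    norm_num [hκ2]
  set W : SpT → ℝ≥0∞ := fun q => ∫⁻ y, rieszK (11 / 4) (y - q.1) * w (y, q.2) ^ (2 : ℝ) ∂μ with hW
  set P : SpT → ℝ≥0∞ := fun q => ∫⁻ y, rieszK (5 / 2) (y - q.1) * v (y, q.2) ^ (3 : ℝ) ∂μ with hP
  have mm : ∀ {α : ℝ} {f : SpT → ℝ≥0∞}, Measurable f →
      Measurable fun q : SpT => ∫⁻ y, rieszK α (y - q.1) * f (y, q.2) ∂μ := by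
    intro α f hf
    refine Measurable.lintegral_prod_right' (f := fun q : (E3 × ℝ) × E3 =>
      rieszK α (q.2 - q.1.1) * f (q.2, q.1.2)) ?_
    exact ((measurable_rieszK α).comp (by fun_prop)).mul (hf.comp (by fun_prop))
  have hw2 : Measurable fun q => w q ^ (2 : ℝ) := by fun_prop
  have hv3 : Measurable fun q => v q ^ (3 : ℝ) := by fun_prop
  have hWm : Measurable W := mm hw2
  have hPm : Measurable P := mm hv3
  have a1 : ∀ᵐ q ∂(μ.prod ν), ∫⁻ y, rieszK (5 / 2) (y - q.1) ∂μ ≤ κ1 :=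
    Measure.quasiMeasurePreserving_fst.ae k1
  have a2 : ∀ᵐ q ∂(μ.prod ν), ∫⁻ y, v (y, q.2) ^ (2 : ℝ) ∂μ ≤ V :=
    Measure.quasiMeasurePreserving_snd.ae hV
  calc ∫⁻ q, (∫⁻ y, rieszK 2 (y - q.1) * (v (y, q.2) * w (y, q.2)) ∂μ) ^ (3 / 2 : ℝ) ∂(μ.prod ν)
      ≤ ∫⁻ q, (V ^ (3 / 8 : ℝ) * κ1 ^ (1 / 8 : ℝ)) * (W q ^ (3 / 4 : ℝ) * P q ^ (1 / 4 : ℝ))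
          ∂(μ.prod ν) := by
        refine lintegral_mono_ae ?_
        filter_upwards [a1, a2] with q h1 h2
        refine (lintegral_rieszK_mul_le (v := fun y => v (y, q.2)) (w := fun y => w (y, q.2))
          (hv.comp (by fun_prop)) (hw.comp (by fun_prop)) q.1).trans ?_
        gcongr
    _ = (V ^ (3 / 8 : ℝ) * κ1 ^ (1 / 8 : ℝ)) *
          ∫⁻ q, W q ^ (3 / 4 : ℝ) * P q ^ (1 / 4 : ℝ) ∂(μ.prod ν) :=
        lintegral_const_mul _ (by fun_prop)
    _ ≤ (V ^ (3 / 8 : ℝ) * κ1 ^ (1 / 8 : ℝ)) * ((∫⁻ q, W q ∂(μ.prod ν)) ^ (3 / 4 : ℝ) *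
          (∫⁻ q, P q ∂(μ.prod ν)) ^ (1 / 4 : ℝ)) := by
        gcongr
        exact ENNReal.lintegral_mul_norm_pow_le hWm.aemeasurable hPm.aemeasurable
          (by norm_num) (by norm_num) (by norm_num)
    _ ≤ (V ^ (3 / 8 : ℝ) * κ1 ^ (1 / 8 : ℝ)) * ((κ2 * ∫⁻ q, w q ^ (2 : ℝ) ∂(μ.prod ν)) ^ (3 / 4 : ℝ)
          * (κ1 * ∫⁻ q, v q ^ (3 : ℝ) ∂(μ.prod ν)) ^ (1 / 4 : ℝ)) := by
        gcongr
        · exact lintegral_lintegral_rieszK_le k2 hw2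
        · exact lintegral_lintegral_rieszK_le k1 hv3
    _ = (κ1 ^ (1 / 8 : ℝ) * κ2 ^ (3 / 4 : ℝ) * κ1 ^ (1 / 4 : ℝ)) * (V ^ (3 / 8 : ℝ) *
        (∫⁻ q, w q ^ (2 : ℝ) ∂(μ.prod ν)) ^ (3 / 4 : ℝ) *
        (∫⁻ q, v q ^ (3 : ℝ) ∂(μ.prod ν)) ^ (1 / 4 : ℝ)) := by
        rw [ENNReal.mul_rpow_of_nonneg _ _ (by norm_num : (0 : ℝ) ≤ 3 / 4),
          ENNReal.mul_rpow_of_nonneg _ _ (by norm_num : (0 : ℝ) ≤ 1 / 4)]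
        ring
    _ = _ := by
        congr 1
        have e : ENNReal.ofReal (ρ ^ (3 / 8 : ℝ)) =
            ENNReal.ofReal (ρ ^ (1 / 2 : ℝ)) ^ (1 / 8 : ℝ) *
            ENNReal.ofReal (ρ ^ (1 / 4 : ℝ)) ^ (3 / 4 : ℝ) *
            ENNReal.ofReal (ρ ^ (1 / 2 : ℝ)) ^ (1 / 4 : ℝ) := by
          simp only [← ENNReal.ofReal_rpow_of_pos hρ, ← ENNReal.rpow_mul]
          rw [← ENNReal.rpow_add_of_nonneg _ _ (by norm_num) (by norm_num),
            ← ENNReal.rpow_add_of_nonneg _ _ (by norm_num) (by norm_num)]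
          norm_num
        rw [e, hκ1, hκ2, ENNReal.mul_rpow_of_nonneg _ _ (by norm_num),
          ENNReal.mul_rpow_of_nonneg _ _ (by norm_num),
          ENNReal.mul_rpow_of_nonneg _ _ (by norm_num)]
        push_cast
        rw [ENNReal.coe_rpow_of_nonneg _ (by norm_num), ENNReal.coe_rpow_of_nonneg _ (by norm_num),
          ENNReal.coe_rpow_of_nonneg _ (by norm_num)]
        ring

theorem ENNReal.mul_le_rpow_two_add_rpow_two (a b : ℝ≥0∞) : a * b ≤ a ^ (2 : ℝ) + b ^ (2 : ℝ) := by
  have h : ∀ x : ℝ≥0∞, x ^ (2 : ℝ) = x * x := fun x => by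
    rw [ENNReal.rpow_two, sq]
  rw [h, h]
  rcases le_total a b with hab | hab
  · exact (mul_le_mul_left hab b).trans le_add_self
  · exact (mul_le_mul_right hab a).trans le_self_add

theorem pressure_scaling_le {r s : ℝ≥0∞} (hr0 : r ≠ 0) (hr : r ≠ ∞) (hs0 : s ≠ 0) (hs : s ≠ ∞)
    {P D A B C a₁ a₂ : ℝ≥0∞}
    (h : P ≤ a₁ * s ^ (3 : ℝ) * (r ^ (2 : ℝ) * D) +
      a₂ * r ^ (3 / 8 : ℝ) * ((r * A) ^ (3 / 8 : ℝ) * (r * B) ^ (3 / 4 : ℝ) *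
        (r ^ (2 : ℝ) * C) ^ (1 / 4 : ℝ))) :
    (s * r) ^ (-2 : ℝ) * P ≤ (a₁ + a₂) * (s * (D + C ^ (1 / 2 : ℝ)) +
      s ^ (-5 : ℝ) * A ^ (3 / 4 : ℝ) * B ^ (3 / 2 : ℝ)) := by
  have hsr : (s * r) ^ (-2 : ℝ) = s ^ (-2 : ℝ) * r ^ (-2 : ℝ) :=
    ENNReal.mul_rpow_of_ne_top hs hr _
  have e1 : s ^ (-2 : ℝ) * s ^ (3 : ℝ) = s := by
    rw [← ENNReal.rpow_add _ _ hs0 hs]; norm_num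
  have e2 : r ^ (-2 : ℝ) * r ^ (2 : ℝ) = 1 := by
    rw [← ENNReal.rpow_add _ _ hr0 hr]; norm_num
  have e3 : r ^ (-2 : ℝ) * (r ^ (3 / 8 : ℝ) * r ^ (3 / 8 : ℝ) * r ^ (3 / 4 : ℝ) *
      (r ^ (2 : ℝ)) ^ (1 / 4 : ℝ)) = 1 := by
    rw [← ENNReal.rpow_mul]
    simp only [← ENNReal.rpow_add _ _ hr0 hr]
    norm_num
  have e4 : s ^ (-2 : ℝ) = s ^ (-(5 / 2) : ℝ) * s ^ (1 / 2 : ℝ) := by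
    rw [← ENNReal.rpow_add _ _ hs0 hs]; norm_num
  have key : s ^ (-2 : ℝ) * (A ^ (3 / 8 : ℝ) * B ^ (3 / 4 : ℝ) * C ^ (1 / 4 : ℝ)) ≤
      s * C ^ (1 / 2 : ℝ) + s ^ (-5 : ℝ) * A ^ (3 / 4 : ℝ) * B ^ (3 / 2 : ℝ) := by
    calc s ^ (-2 : ℝ) * (A ^ (3 / 8 : ℝ) * B ^ (3 / 4 : ℝ) * C ^ (1 / 4 : ℝ))
        = (s ^ (1 / 2 : ℝ) * C ^ (1 / 4 : ℝ)) *
            (s ^ (-(5 / 2) : ℝ) * A ^ (3 / 8 : ℝ) * B ^ (3 / 4 : ℝ)) := by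
          rw [e4]; ring
      _ ≤ _ := ENNReal.mul_le_rpow_two_add_rpow_two _ _
      _ = s * C ^ (1 / 2 : ℝ) + s ^ (-5 : ℝ) * A ^ (3 / 4 : ℝ) * B ^ (3 / 2 : ℝ) := by
          simp only [ENNReal.mul_rpow_of_nonneg _ _ (by norm_num : (0 : ℝ) ≤ 2), ← ENNReal.rpow_mul]
          norm_num
  calc (s * r) ^ (-2 : ℝ) * P
      ≤ s ^ (-2 : ℝ) * r ^ (-2 : ℝ) * (a₁ * s ^ (3 : ℝ) * (r ^ (2 : ℝ) * D) +
      a₂ * r ^ (3 / 8 : ℝ) * ((r * A) ^ (3 / 8 : ℝ) * (r * B) ^ (3 / 4 : ℝ) *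
        (r ^ (2 : ℝ) * C) ^ (1 / 4 : ℝ))) := by
        rw [hsr]; gcongr
    _ = a₁ * ((s ^ (-2 : ℝ) * s ^ (3 : ℝ)) * (r ^ (-2 : ℝ) * r ^ (2 : ℝ)) * D) +
        a₂ * ((r ^ (-2 : ℝ) * (r ^ (3 / 8 : ℝ) * r ^ (3 / 8 : ℝ) * r ^ (3 / 4 : ℝ) *
          (r ^ (2 : ℝ)) ^ (1 / 4 : ℝ))) *
          (s ^ (-2 : ℝ) * (A ^ (3 / 8 : ℝ) * B ^ (3 / 4 : ℝ) * C ^ (1 / 4 : ℝ)))) := by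
        rw [ENNReal.mul_rpow_of_nonneg r A (by norm_num),
          ENNReal.mul_rpow_of_nonneg r B (by norm_num),
          ENNReal.mul_rpow_of_nonneg _ C (by norm_num)]
        ring
    _ ≤ a₁ * (s * D) + a₂ * (s * C ^ (1 / 2 : ℝ) +
          s ^ (-5 : ℝ) * A ^ (3 / 4 : ℝ) * B ^ (3 / 2 : ℝ)) := by
        rw [e1, e2, e3, mul_one, one_mul]
        gcongr
    _ ≤ (a₁ + a₂) * (s * (D + C ^ (1 / 2 : ℝ)) +
          s ^ (-5 : ℝ) * A ^ (3 / 4 : ℝ) * B ^ (3 / 2 : ℝ)) := by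
        rw [add_mul]
        gcongr
        · rw [mul_add, add_assoc]
          exact le_self_add
        · exact le_add_self

theorem lintegral_rpow_three_halves_le {α : Type*} [MeasurableSpace α] {μ : Measure α}
    {f : α → ℝ≥0∞} (hf : Measurable f) :
    (∫⁻ x, f x ∂μ) ^ (3 / 2 : ℝ) ≤ μ univ ^ (1 / 2 : ℝ) * ∫⁻ x, f x ^ (3 / 2 : ℝ) ∂μ := by
  have h := ENNReal.lintegral_mul_norm_pow_le (μ := μ) (f := fun x => f x ^ (3 / 2 : ℝ))
    (g := fun _ => 1) (p := 2 / 3) (q := 1 / 3) (by fun_prop) (by fun_prop)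
    (by norm_num) (by norm_num) (by norm_num)
  simp only [ENNReal.one_rpow, mul_one, ← ENNReal.rpow_mul, lintegral_const, one_mul] at h
  norm_num at h
  refine (ENNReal.rpow_le_rpow h (by norm_num)).trans (le_of_eq ?_)
  rw [ENNReal.mul_rpow_of_nonneg _ _ (by norm_num), ← ENNReal.rpow_mul, ← ENNReal.rpow_mul,
    mul_comm]
  norm_num

theorem volume_ball_E3 (x : E3) {r : ℝ} (hr : 0 < r) :
    volume (Metric.ball x r) =
      ENNReal.ofReal r ^ (3 : ℝ) * volume (Metric.ball (0 : E3) 1) := by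
  rw [Measure.addHaar_ball_of_pos _ _ hr, finrank_euclideanSpace, Fintype.card_fin,
    ENNReal.ofReal_pow hr.le]
  norm_cast

theorem setIntegral_mul_isTestOn {Q U : Set SpT} (hU : MeasurableSet U) (hQU : Q ⊆ U)
    {f ψ : SpT → ℝ} (hψ : IsTestOn Q ψ) : ∫ z in U, f z * ψ z = ∫ z in Q, f z * ψ z := by
  refine setIntegral_eq_of_subset_of_forall_sdiff_eq_zero hU hQU fun z hz => ?_
  rw [image_eq_zero_of_notMem_tsupport fun h => hz.2 (hψ.2.2 h), mul_zero]

theorem IsTestOn.mono {Q U : Set SpT} (hQU : Q ⊆ U) {ψ : SpT → ℝ} (hψ : IsTestOn Q ψ) :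
    IsTestOn U ψ := ⟨hψ.1, hψ.2.1, hψ.2.2.trans hQU⟩

theorem WeakSGrad.mono {Q U : Set SpT} (hU : MeasurableSet U) (hQU : Q ⊆ U) {f : SpT → ℝ}
    {g : Fin 3 → SpT → ℝ} (h : WeakSGrad U f g) : WeakSGrad Q f g := by
  intro j ψ hψ
  rw [← setIntegral_mul_isTestOn hU hQU hψ, ← setIntegral_mul_isTestOn hU hQU (hψ.sderiv j)]
  exact h j ψ (hψ.mono hQU)

theorem PressureEqOn.mono {Q U : Set SpT} (hU : MeasurableSet U) (hQU : Q ⊆ U) {u : SpT → E3}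
    {p : SpT → ℝ} {Dd : SpT → Fin 3 → Fin 3 → ℝ} (h : PressureEqOn U u p Dd) :
    PressureEqOn Q u p Dd := by
  intro ψ hψ
  have h1 := h ψ (hψ.mono hQU)
  have hz : ∀ i j, ∀ z ∉ Q, sderiv i (sderiv j ψ) z = 0 := fun i j z hz =>
    image_eq_zero_of_notMem_tsupport fun h => hz (((hψ.sderiv j).sderiv i).2.2 h)
  rw [setIntegral_eq_of_subset_of_forall_sdiff_eq_zero hU hQU,
    setIntegral_eq_of_subset_of_forall_sdiff_eq_zero hU hQU] at h1
  · exact h1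
  · intro z hzz
    simp [hz _ _ z hzz.2]
  · intro z hzz
    simp [sLap, hz _ _ z hzz.2]

theorem memLp_two_of_enorm_le {Q : Set SpT} {f : SpT → ℝ} {v : SpT → ℝ≥0∞} (hf : Measurable f)
    (h : ∀ z, ‖f z‖ₑ ≤ v z) (hv : ∫⁻ z in Q, v z ^ (2 : ℝ) < ∞) :
    MemLp f 2 (volume.restrict Q) := by
  refine ⟨hf.aestronglyMeasurable, ?_⟩
  rw [eLpNorm_lt_top_iff_lintegral_rpow_enorm_lt_top (by norm_num) (by norm_num)]
  refine lt_of_le_of_lt (lintegral_mono fun z => ?_) hv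
  simp only [ENNReal.toReal_ofNat]
  gcongr
  exact h z

theorem integrableOn_of_rpow {Q : Set SpT} (hQ : volume Q < ∞) {p : SpT → ℝ} (hp : Measurable p)
    (h : IntegrableOn (fun z => |p z| ^ ((3 : ℝ) / 2)) Q) : IntegrableOn p Q := by
  have h1 : IntegrableOn (fun _ : SpT => (1 : ℝ)) Q := integrableOn_const hQ.ne
  refine (h1.add h).mono' hp.aestronglyMeasurable (ae_of_all _ fun z => ?_)
  simp only [Pi.add_apply, Real.norm_eq_abs]
  rcases le_total |p z| 1 with h2 | h2
  · have : 0 ≤ |p z| ^ ((3 : ℝ) / 2) := by positivity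
    linarith
  · have := Real.self_le_rpow_of_one_le h2 (by norm_num : (1 : ℝ) ≤ 3 / 2)
    linarith

theorem sq_le_nsq2 (M : Fin 3 → Fin 3 → ℝ) (i j : Fin 3) : (M i j) ^ 2 ≤ nsq2 M := by
  unfold nsq2
  refine le_trans ?_ (Finset.single_le_sum (f := fun i => ∑ j, (M i j) ^ 2)
    (fun i _ => Finset.sum_nonneg fun j _ => sq_nonneg _) (Finset.mem_univ i))
  exact Finset.single_le_sum (f := fun j => (M i j) ^ 2) (fun j _ => sq_nonneg _)
    (Finset.mem_univ j)

theorem nsq2_nonneg (M : Fin 3 → Fin 3 → ℝ) : 0 ≤ nsq2 M :=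
  (sq_nonneg (M 0 0)).trans (sq_le_nsq2 M 0 0)

theorem sq_le_nsq3 (A : Fin 3 → Fin 3 → Fin 3 → ℝ) (i j k : Fin 3) :
    (A i j k) ^ 2 ≤ nsq3 A := by
  refine (sq_le_nsq2 (A i) j k).trans ?_
  exact Finset.single_le_sum (f := fun i => nsq2 (A i)) (fun i _ => nsq2_nonneg _)
    (Finset.mem_univ i)

theorem nsq3_nonneg (A : Fin 3 → Fin 3 → Fin 3 → ℝ) : 0 ≤ nsq3 A :=
  (sq_nonneg (A 0 0 0)).trans (sq_le_nsq3 A 0 0 0)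

theorem measurable_nsq2 : Measurable nsq2 := by
  unfold nsq2; fun_prop

theorem measurable_nsq3 : Measurable nsq3 := by
  unfold nsq3; fun_prop

/-- The magnitude of `(u, ∇d)`. -/
def speed (u : SpT → E3) (Dd : SpT → Fin 3 → Fin 3 → ℝ) (z : SpT) : ℝ≥0∞ :=
  ENNReal.ofReal (Real.sqrt (‖u z‖ ^ 2 + nsq2 (Dd z)))

/-- The magnitude of `(∇u, ∇²d)`. -/
def gradSpeed (Du : SpT → Fin 3 → Fin 3 → ℝ) (D2d : SpT → Fin 3 → Fin 3 → Fin 3 → ℝ)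
    (z : SpT) : ℝ≥0∞ :=
  ENNReal.ofReal (Real.sqrt (nsq2 (Du z) + nsq3 (D2d z)))

theorem ofReal_sqrt_rpow_two {x : ℝ} (hx : 0 ≤ x) :
    ENNReal.ofReal (Real.sqrt x) ^ (2 : ℝ) = ENNReal.ofReal x := by
  rw [ENNReal.ofReal_rpow_of_nonneg (Real.sqrt_nonneg _) (by norm_num)]
  norm_num [Real.sq_sqrt hx]

theorem speed_rpow_three_le (u : SpT → E3) (Dd : SpT → Fin 3 → Fin 3 → ℝ) (z : SpT) :
    speed u Dd z ^ (3 : ℝ) ≤ 4 * ENNReal.ofReal (‖u z‖ ^ 3 + Real.sqrt (nsq2 (Dd z)) ^ 3) := by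
  unfold speed
  rw [ENNReal.ofReal_rpow_of_nonneg (Real.sqrt_nonneg _) (by norm_num),
    show (4 : ℝ≥0∞) = ENNReal.ofReal 4 by norm_num, ← ENNReal.ofReal_mul (by norm_num)]
  refine ENNReal.ofReal_le_ofReal ?_
  have h0 := nsq2_nonneg (Dd z)
  set a := ‖u z‖
  set b := Real.sqrt (nsq2 (Dd z)) with hb
  have ha : 0 ≤ a := norm_nonneg _
  have hb0 : 0 ≤ b := Real.sqrt_nonneg _
  have h1 : Real.sqrt (a ^ 2 + nsq2 (Dd z)) ≤ a + b := by
    refine Real.sqrt_le_iff.2 ⟨by positivity, ?_⟩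
    have : nsq2 (Dd z) = b ^ 2 := (Real.sq_sqrt h0).symm
    rw [this]
    nlinarith [mul_nonneg ha hb0]
  calc Real.sqrt (a ^ 2 + nsq2 (Dd z)) ^ (3 : ℝ) ≤ (a + b) ^ (3 : ℝ) := by
        gcongr
    _ = (a + b) ^ 3 := by norm_cast
    _ ≤ 4 * (a ^ 3 + b ^ 3) := by nlinarith [mul_nonneg (add_nonneg ha hb0) (sq_nonneg (a - b))]

theorem enorm_le_ofReal_sqrt {a x : ℝ} (h : a ^ 2 ≤ x) : ‖a‖ₑ ≤ ENNReal.ofReal (Real.sqrt x) := by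
  rw [Real.enorm_eq_ofReal_abs]
  exact ENNReal.ofReal_le_ofReal (Real.abs_le_sqrt h)

section Bounds

variable (u : SpT → E3) (Du Dd : SpT → Fin 3 → Fin 3 → ℝ)
  (D2d : SpT → Fin 3 → Fin 3 → Fin 3 → ℝ) (z : SpT)

theorem enorm_apply_le_speed (i : Fin 3) : ‖u z i‖ₑ ≤ speed u Dd z := by
  refine enorm_le_ofReal_sqrt ?_
  have h1 : (u z i) ^ 2 ≤ ‖u z‖ ^ 2 := sq_le_sq' (by
    have := (abs_le.1 (PiLp.norm_apply_le (u z) i)).1; linarith)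
    ((le_abs_self _).trans (PiLp.norm_apply_le (u z) i))
  linarith [nsq2_nonneg (Dd z)]

theorem enorm_grad_apply_le_speed (i j : Fin 3) : ‖Dd z i j‖ₑ ≤ speed u Dd z := by
  refine enorm_le_ofReal_sqrt ?_
  linarith [sq_le_nsq2 (Dd z) i j, sq_nonneg ‖u z‖]

theorem enorm_apply_le_gradSpeed (i j : Fin 3) : ‖Du z i j‖ₑ ≤ gradSpeed Du D2d z := by
  refine enorm_le_ofReal_sqrt ?_
  linarith [sq_le_nsq2 (Du z) i j, nsq3_nonneg (D2d z)]

theorem enorm_hess_apply_le_gradSpeed (i j k : Fin 3) : ‖D2d z i j k‖ₑ ≤ gradSpeed Du D2d z := by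
  refine enorm_le_ofReal_sqrt ?_
  linarith [sq_le_nsq3 (D2d z) i j k, nsq2_nonneg (Du z)]

theorem enorm_stressDiv_le (j : Fin 3) :
    ‖stressDiv u Du Dd D2d j z‖ₑ ≤ 24 * (speed u Dd z * gradSpeed Du D2d z) := by
  set m := speed u Dd z * gradSpeed Du D2d z with hm
  have t1 : ∀ i i' k, ‖Du z i i' * u z k‖ₑ ≤ m := fun i i' k => by
    rw [enorm_mul, hm, mul_comm]
    exact mul_le_mul' (enorm_apply_le_speed u Dd z k) (enorm_apply_le_gradSpeed Du D2d z i i')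
  have t2 : ∀ i i' k, ‖u z k * Du z i i'‖ₑ ≤ m := fun i i' k => by
    rw [mul_comm]; exact t1 i i' k
  have t3 : ∀ k i i' l l', ‖D2d z k i i' * Dd z l l'‖ₑ ≤ m := fun k i i' l l' => by
    rw [enorm_mul, hm, mul_comm]
    exact mul_le_mul' (enorm_grad_apply_le_speed u Dd z l l')
      (enorm_hess_apply_le_gradSpeed Du D2d z k i i')
  have t4 : ∀ k i i' l l', ‖Dd z l l' * D2d z k i i'‖ₑ ≤ m := fun k i i' l l' => by
    rw [mul_comm]; exact t3 k i i' l l'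
  have hk : ∀ i k, ‖D2d z k i i * Dd z k j + Dd z k i * D2d z k i j‖ₑ ≤ m + m :=
    fun i k => (enorm_add_le _ _).trans (add_le_add (t3 _ _ _ _ _) (t4 _ _ _ _ _))
  have hi : ∀ i, ‖(Du z i i * u z j + u z i * Du z j i) +
      ∑ k, (D2d z k i i * Dd z k j + Dd z k i * D2d z k i j)‖ₑ ≤ (m + m) + 3 * (m + m) := by
    intro i
    refine (enorm_add_le _ _).trans (add_le_add ((enorm_add_le _ _).trans
      (add_le_add (t1 _ _ _) (t2 _ _ _))) ((enorm_sum_le _ _).trans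
      ((Finset.sum_le_sum fun k _ => hk i k).trans (le_of_eq ?_))))
    simp [mul_add]
  calc ‖stressDiv u Du Dd D2d j z‖ₑ ≤ ∑ i : Fin 3, ((m + m) + 3 * (m + m)) :=
        (enorm_sum_le _ _).trans (Finset.sum_le_sum fun i _ => hi i)
    _ = 24 * m := by
        simp only [Finset.sum_const, Finset.card_univ, Fintype.card_fin, nsmul_eq_mul]
        push_cast
        ring

end Bounds

theorem exists_setLIntegral_pressure_le : ∃ a₁ a₂ : ℝ≥0, ∀ (x₀ : E3) (ρ : ℝ) (I : Set ℝ), 0 < ρ →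
    IsOpen I → ∀ (p : SpT → ℝ) (G : Fin 3 → SpT → ℝ) (v w : SpT → ℝ≥0∞) (V : ℝ≥0∞),
    Measurable p → Measurable v → Measurable w → (∀ j z, ‖G j z‖ₑ ≤ 24 * (v z * w z)) →
    IntegrableOn p (Metric.ball x₀ ρ ×ˢ I) → (∀ j, IntegrableOn (G j) (Metric.ball x₀ ρ ×ˢ I)) →
    PressureDivEqOn (Metric.ball x₀ ρ ×ˢ I) p G →
    (∀ᵐ t ∂(volume.restrict I), ∫⁻ y in Metric.ball x₀ ρ, v (y, t) ^ (2 : ℝ) ≤ V) →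
    ∀ γ ∈ Ioc (0 : ℝ) (1 / 2),
    ∫⁻ z in Metric.ball x₀ (γ * ρ) ×ˢ I, ‖p z‖ₑ ^ (3 / 2 : ℝ) ≤
      a₁ * ENNReal.ofReal γ ^ (3 : ℝ) * (∫⁻ z in Metric.ball x₀ ρ ×ˢ I, ‖p z‖ₑ ^ (3 / 2 : ℝ)) +
      a₂ * ENNReal.ofReal ρ ^ (3 / 8 : ℝ) * (V ^ (3 / 8 : ℝ) *
        (∫⁻ q in Metric.ball x₀ ρ ×ˢ I, w q ^ (2 : ℝ)) ^ (3 / 4 : ℝ) *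
        (∫⁻ q in Metric.ball x₀ ρ ×ˢ I, v q ^ (3 : ℝ)) ^ (1 / 4 : ℝ)) := by
  obtain ⟨c, hc⟩ := exists_ae_ae_enorm_pressure_le
  obtain ⟨c', hc'⟩ := exists_lintegral_rieszK_rpow_le
  set β : ℝ≥0∞ := volume (Metric.ball (0 : E3) 1) with hβ
  have hβt : β ≠ ∞ := measure_ball_lt_top.ne
  set K : ℝ≥0∞ := c ^ (3 / 2 : ℝ) * 2 ^ (1 / 2 : ℝ) with hK
  have hKt : K ≠ ∞ := ENNReal.mul_ne_top (ENNReal.rpow_ne_top_of_nonneg (by norm_num) (by simp))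
    (ENNReal.rpow_ne_top_of_nonneg (by norm_num) (by simp))
  have h24 : (24 : ℝ≥0∞) ^ (3 / 2 : ℝ) ≠ ∞ :=
    ENNReal.rpow_ne_top_of_nonneg (by norm_num) (by simp)
  refine ⟨(K * β ^ (3 / 2 : ℝ)).toNNReal, (K * (24 ^ (3 / 2 : ℝ) * c')).toNNReal, ?_⟩
  intro x₀ ρ I hρ hI p G v w V hp hv hw hG hpi hGi hpG hV γ hγ
  rw [ENNReal.coe_toNNReal (ENNReal.mul_ne_top hKt
    (ENNReal.rpow_ne_top_of_nonneg (by norm_num) hβt)),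
    ENNReal.coe_toNNReal (ENNReal.mul_ne_top hKt (ENNReal.mul_ne_top h24 (by simp)))]
  have hγρ : 0 < γ * ρ := mul_pos hγ.1 hρ
  have hsub2 : Metric.ball x₀ (γ * ρ) ⊆ Metric.ball x₀ (ρ / 2) :=
    Metric.ball_subset_ball (by nlinarith [hγ.2])
  have hsub1 : Metric.ball x₀ (γ * ρ) ⊆ Metric.ball x₀ ρ :=
    Metric.ball_subset_ball (by nlinarith [hγ.2])
  have hb := hc x₀ ρ I hρ hI p G (fun z => 24 * (v z * w z)) hp (by fun_prop) hG hpi hGi hpG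
  have hr := hc' x₀ ρ I hρ v w V hv hw hV
  set r := ENNReal.ofReal ρ with hr_def
  set s := ENNReal.ofReal γ with hs_def
  have hr0 : r ≠ 0 := by simpa [hr_def] using hρ
  have hrt : r ≠ ∞ := ENNReal.ofReal_ne_top
  set μ := (volume : Measure E3).restrict (Metric.ball x₀ ρ) with hμ
  set σ := (volume : Measure E3).restrict (Metric.ball x₀ (γ * ρ)) with hσ
  set ν := (volume : Measure ℝ).restrict I with hν
  have hvol : (volume : Measure SpT).restrict (Metric.ball x₀ ρ ×ˢ I) = μ.prod ν :=
    (Measure.prod_restrict _ I).symm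
  have hvol' : (volume : Measure SpT).restrict (Metric.ball x₀ (γ * ρ) ×ˢ I) = σ.prod ν :=
    (Measure.prod_restrict _ I).symm
  set Y : SpT → ℝ≥0∞ := fun q => ∫⁻ y, rieszK 2 (y - q.1) * (v (y, q.2) * w (y, q.2)) ∂μ with hY
  set H : ℝ → ℝ≥0∞ := fun t => ENNReal.ofReal (ρ ^ 3)⁻¹ * ∫⁻ y, ‖p (y, t)‖ₑ ∂μ with hH
  have mY : Measurable Y := by
    refine Measurable.lintegral_prod_right' (f := fun q : (E3 × ℝ) × E3 =>
      rieszK 2 (q.2 - q.1.1) * (v (q.2, q.1.2) * w (q.2, q.1.2))) ?_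
    exact ((measurable_rieszK 2).comp (by fun_prop)).mul
      ((hv.comp (by fun_prop)).mul (hw.comp (by fun_prop)))
  have mH : Measurable H := Measurable.const_mul (Measurable.lintegral_prod_left'
    (f := fun q : SpT => ‖p q‖ₑ) (by fun_prop)) _
  have mHz : Measurable fun z : SpT => H z.2 ^ (3 / 2 : ℝ) :=
    (mH.comp measurable_snd).pow_const _
  have mp : Measurable fun z => ‖p z‖ₑ ^ (3 / 2 : ℝ) := by fun_prop
  have hHs : (∫⁻ t, H t ^ (3 / 2 : ℝ) ∂ν) * σ univ ≤
      β ^ (3 / 2 : ℝ) * s ^ (3 : ℝ) * ∫⁻ z, ‖p z‖ₑ ^ (3 / 2 : ℝ) ∂(μ.prod ν) := by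
    have hσu : σ univ = s ^ (3 : ℝ) * r ^ (3 : ℝ) * β := by
      rw [hσ, Measure.restrict_apply_univ, volume_ball_E3 _ hγρ, ENNReal.ofReal_mul hγ.1.le,
        ENNReal.mul_rpow_of_nonneg _ _ (by norm_num)]
    have hμu : μ univ = r ^ (3 : ℝ) * β := by
      rw [hμ, Measure.restrict_apply_univ, volume_ball_E3 _ hρ]
    have h3 : ENNReal.ofReal (ρ ^ 3)⁻¹ = r ^ (-3 : ℝ) := by
      rw [hr_def, ENNReal.ofReal_rpow_of_pos hρ, Real.rpow_neg hρ.le]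
      norm_cast
    have hpt : ∀ t, H t ^ (3 / 2 : ℝ) ≤ (r ^ (-3 : ℝ)) ^ (3 / 2 : ℝ) *
        ((r ^ (3 : ℝ) * β) ^ (1 / 2 : ℝ)) * ∫⁻ y, ‖p (y, t)‖ₑ ^ (3 / 2 : ℝ) ∂μ := fun t => by
      rw [hH, ← h3, ENNReal.mul_rpow_of_nonneg _ _ (by norm_num), mul_assoc, ← hμu]
      gcongr
      exact lintegral_rpow_three_halves_le (by fun_prop)
    have e : (r ^ (-3 : ℝ)) ^ (3 / 2 : ℝ) * ((r ^ (3 : ℝ)) ^ (1 / 2 : ℝ)) * r ^ (3 : ℝ) = 1 := by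
      simp only [← ENNReal.rpow_mul, ← ENNReal.rpow_add _ _ hr0 hrt]
      norm_num
    have eβ : β ^ (1 / 2 : ℝ) * β = β ^ (3 / 2 : ℝ) := by
      conv_lhs => rw [← ENNReal.rpow_one β, ← ENNReal.rpow_mul]
      rw [← ENNReal.rpow_add_of_nonneg _ _ (by norm_num) (by norm_num)]
      norm_num
    calc (∫⁻ t, H t ^ (3 / 2 : ℝ) ∂ν) * σ univ
        ≤ (∫⁻ t, (r ^ (-3 : ℝ)) ^ (3 / 2 : ℝ) * ((r ^ (3 : ℝ) * β) ^ (1 / 2 : ℝ)) *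
            ∫⁻ y, ‖p (y, t)‖ₑ ^ (3 / 2 : ℝ) ∂μ ∂ν) * (s ^ (3 : ℝ) * r ^ (3 : ℝ) * β) := by
          rw [hσu]
          gcongr with t
          exact hpt t
      _ = (r ^ (-3 : ℝ)) ^ (3 / 2 : ℝ) * ((r ^ (3 : ℝ) * β) ^ (1 / 2 : ℝ)) *
            (∫⁻ z, ‖p z‖ₑ ^ (3 / 2 : ℝ) ∂(μ.prod ν)) * (s ^ (3 : ℝ) * r ^ (3 : ℝ) * β) := by
          rw [lintegral_const_mul _ mp.lintegral_prod_left', lintegral_prod_symm' _ mp]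
      _ = ((r ^ (-3 : ℝ)) ^ (3 / 2 : ℝ) * ((r ^ (3 : ℝ)) ^ (1 / 2 : ℝ)) * r ^ (3 : ℝ)) *
            (β ^ (1 / 2 : ℝ) * β) * s ^ (3 : ℝ) * ∫⁻ z, ‖p z‖ₑ ^ (3 / 2 : ℝ) ∂(μ.prod ν) := by
          rw [ENNReal.mul_rpow_of_nonneg _ β (by norm_num : (0 : ℝ) ≤ 1 / 2)]
          ring
      _ = _ := by rw [e, eβ, one_mul]
  have hYs : ∫⁻ z, Y z ^ (3 / 2 : ℝ) ∂(σ.prod ν) ≤ ∫⁻ z, Y z ^ (3 / 2 : ℝ) ∂(μ.prod ν) :=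
    lintegral_mono' (Measure.prod_mono (Measure.restrict_mono_set _ hsub1) le_rfl) le_rfl
  rw [hvol']
  rw [hvol] at hr ⊢
  calc ∫⁻ z, ‖p z‖ₑ ^ (3 / 2 : ℝ) ∂(σ.prod ν)
      = ∫⁻ t, ∫⁻ x, ‖p (x, t)‖ₑ ^ (3 / 2 : ℝ) ∂σ ∂ν := lintegral_prod_symm' _ mp
    _ ≤ ∫⁻ t, ∫⁻ x, K * (H t ^ (3 / 2 : ℝ) + 24 ^ (3 / 2 : ℝ) * Y (x, t) ^ (3 / 2 : ℝ)) ∂σ ∂ν := by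
        refine lintegral_mono_ae ?_
        filter_upwards [hb] with t ht
        refine lintegral_mono_ae ?_
        filter_upwards [ae_restrict_of_ae_restrict_of_subset hsub2 ht] with x hx
        have hx' : ‖p (x, t)‖ₑ ≤ c * (H t + 24 * Y (x, t)) := by
          have h24Y : ∫⁻ y, rieszK 2 (y - x) * (24 * (v (y, t) * w (y, t))) ∂μ = 24 * Y (x, t) := by
            rw [hY, ← lintegral_const_mul' _ _ (by simp)]
            exact lintegral_congr fun y => by ring
          rw [← h24Y]
          exact hx
        calc ‖p (x, t)‖ₑ ^ (3 / 2 : ℝ) ≤ (c * (H t + 24 * Y (x, t))) ^ (3 / 2 : ℝ) := by gcongr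
          _ = c ^ (3 / 2 : ℝ) * (H t + 24 * Y (x, t)) ^ (3 / 2 : ℝ) :=
              ENNReal.mul_rpow_of_nonneg _ _ (by norm_num)
          _ ≤ c ^ (3 / 2 : ℝ) * (2 ^ ((3 / 2 : ℝ) - 1) *
                (H t ^ (3 / 2 : ℝ) + (24 * Y (x, t)) ^ (3 / 2 : ℝ))) := by
              gcongr
              exact ENNReal.rpow_add_le_mul_rpow_add_rpow _ _ (by norm_num)
          _ = _ := by
              rw [ENNReal.mul_rpow_of_nonneg _ (Y (x, t)) (by norm_num), hK, mul_assoc]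
              norm_num
    _ = ∫⁻ z, K * (H z.2 ^ (3 / 2 : ℝ) + 24 ^ (3 / 2 : ℝ) * Y z ^ (3 / 2 : ℝ)) ∂(σ.prod ν) :=
        (lintegral_prod_symm' _ ((mHz.add ((mY.pow_const _).const_mul _)).const_mul _)).symm
    _ = K * ((∫⁻ t, H t ^ (3 / 2 : ℝ) ∂ν) * σ univ +
          24 ^ (3 / 2 : ℝ) * ∫⁻ z, Y z ^ (3 / 2 : ℝ) ∂(σ.prod ν)) := by
        rw [lintegral_const_mul _ (by fun_prop), lintegral_add_left mHz,
          lintegral_const_mul _ (mY.pow_const _),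
          lintegral_prod_symm' _ mHz]
        simp only [lintegral_const]
        rw [lintegral_mul_const _ (by fun_prop)]
    _ ≤ K * (β ^ (3 / 2 : ℝ) * s ^ (3 : ℝ) * ∫⁻ z, ‖p z‖ₑ ^ (3 / 2 : ℝ) ∂(μ.prod ν) +
          24 ^ (3 / 2 : ℝ) * (c' * ENNReal.ofReal (ρ ^ (3 / 8 : ℝ)) * (V ^ (3 / 8 : ℝ) *
        (∫⁻ q, w q ^ (2 : ℝ) ∂(μ.prod ν)) ^ (3 / 4 : ℝ) *
        (∫⁻ q, v q ^ (3 : ℝ) ∂(μ.prod ν)) ^ (1 / 4 : ℝ)))) := by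
        gcongr
        exact hYs.trans hr
    _ = _ := by
        rw [← ENNReal.ofReal_rpow_of_pos hρ]
        ring

/-- There is a universal constant `c₃ > 0` such that
`D(γρ) ≤ c₃ (γ (D(ρ) + A(ρ)^{3/4}B(ρ)^{3/4} + C(ρ)^{1/2}) + γ^{-5} A(ρ)^{3/4} B(ρ)^{3/2})`. -/
theorem stmt13 :
    ∃ c₃ : ℝ, 0 < c₃ ∧
      ∀ (Ω : Set E3), IsOpen Ω → ∀ T : ℝ, 0 < T →
      ∀ (u d : SpT → E3) (p : SpT → ℝ) (Du Dd : SpT → Fin 3 → Fin 3 → ℝ)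
        (D2d : SpT → Fin 3 → Fin 3 → Fin 3 → ℝ),
      StdReg Ω T u d p Du Dd D2d →
      PressureEqOn (Ω ×ˢ Ioo 0 T) u p Dd →
      ∀ (z₀ : SpT) (ρ : ℝ), 0 < ρ → Qstar z₀ ρ ⊆ Ω ×ˢ Ioo 0 T →
      ∀ γ : ℝ, γ ∈ Ioc (0 : ℝ) (1 / 2) →
      DQ p z₀ (γ * ρ) ≤ ENNReal.ofReal c₃ *
        (ENNReal.ofReal γ * (DQ p z₀ ρ +
            AQ u Dd z₀ ρ ^ ((3 : ℝ) / 4) * BQ Du D2d z₀ ρ ^ ((3 : ℝ) / 4) +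
            CQ u Dd z₀ ρ ^ ((1 : ℝ) / 2)) +
         ENNReal.ofReal (γ ^ (-5 : ℝ)) * AQ u Dd z₀ ρ ^ ((3 : ℝ) / 4) *
           BQ Du D2d z₀ ρ ^ ((3 : ℝ) / 2)) := by
  obtain ⟨a₁, a₂, ha⟩ := exists_setLIntegral_pressure_le
  refine ⟨2 * (a₁ + a₂) + 1, by positivity, ?_⟩
  intro Ω hΩ T _ u d p Du Dd D2d hreg hpress z₀ ρ hρ hQU γ hγ
  have hU : MeasurableSet (Ω ×ˢ Ioo (0 : ℝ) T) := (hΩ.prod isOpen_Ioo).measurableSet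
  set r := ENNReal.ofReal ρ with hr_def
  set s := ENNReal.ofReal γ with hs_def
  have hr0 : r ≠ 0 := by simpa [hr_def] using hρ
  have hrt : r ≠ ∞ := ENNReal.ofReal_ne_top
  have hs0 : s ≠ 0 := by simpa [hs_def] using hγ.1
  have hst : s ≠ ∞ := ENNReal.ofReal_ne_top
  set c := ENNReal.ofReal (2 * ((a₁ : ℝ) + a₂) + 1) with hc
  have hc0 : c ≠ 0 := by
    rw [hc, ne_eq, ENNReal.ofReal_eq_zero, not_le]
    positivity
  rcases eq_or_ne (CQ u Dd z₀ ρ) ∞ with hC | hC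
  · rw [hC, ENNReal.top_rpow_of_pos (by norm_num), add_top, ENNReal.mul_top hs0, top_add,
      ENNReal.mul_top hc0]
    exact le_top
  have hcle : 2 * ((a₁ : ℝ≥0∞) + a₂) ≤ c := by
    rw [hc, show (2 * ((a₁ : ℝ) + a₂) + 1) = ((2 * (a₁ + a₂) + 1 : ℝ≥0) : ℝ) by push_cast; rfl,
      ENNReal.ofReal_coe_nnreal]
    push_cast
    exact le_self_add
  set I := Istar z₀.2 ρ with hI_def
  have hI : IsOpen I := isOpen_Ioo
  have hQ : Qstar z₀ ρ = Metric.ball z₀.1 ρ ×ˢ I := rfl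
  have hQo : IsOpen (Qstar z₀ ρ) := hQ ▸ Metric.isOpen_ball.prod hI
  have hQvol : volume (Qstar z₀ ρ) < ∞ := by
    rw [hQ, Measure.volume_eq_prod, Measure.prod_prod]
    exact ENNReal.mul_lt_top measure_ball_lt_top measure_Ioo_lt_top
  have hr2 : ENNReal.ofReal (ρ ^ 2) = r ^ (2 : ℝ) := by
    rw [ENNReal.ofReal_pow hρ.le]
    norm_cast
  have cancel : ∀ (x y : ℝ≥0∞), x ≠ 0 → x ≠ ∞ → x * (x⁻¹ * y) = y := fun x y h0 h1 => by
    rw [← mul_assoc, ENNReal.mul_inv_cancel h0 h1, one_mul]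
  have hr20 : r ^ (2 : ℝ) ≠ 0 := by simp [hr0]
  have hr2t : r ^ (2 : ℝ) ≠ ∞ := by simp [hrt]
  have mu : ∀ i, Measurable fun z => u z i := fun i => by
    have := hreg.meas_u
    fun_prop
  have mDu : ∀ i j, Measurable fun z => Du z i j := fun i j => by
    have := hreg.meas_Du
    fun_prop
  have mDd : ∀ i j, Measurable fun z => Dd z i j := fun i j => by
    have := hreg.meas_Dd
    fun_prop
  have mD2d : ∀ i j k, Measurable fun z => D2d z i j k := fun i j k => by
    have := hreg.meas_D2d
    fun_prop
  have mv : Measurable (speed u Dd) :=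
    ((hreg.meas_u.norm.pow_const 2).add
      (measurable_nsq2.comp hreg.meas_Dd)).sqrt.ennreal_ofReal
  have mw : Measurable (gradSpeed Du D2d) :=
    ((measurable_nsq2.comp hreg.meas_Du).add
      (measurable_nsq3.comp hreg.meas_D2d)).sqrt.ennreal_ofReal
  have hv3 : ∫⁻ z in Qstar z₀ ρ, speed u Dd z ^ (3 : ℝ) ≤ r ^ (2 : ℝ) * (4 * CQ u Dd z₀ ρ) := by
    rw [CQ, hr2, mul_left_comm, cancel _ _ hr20 hr2t, ← lintegral_const_mul' _ _ (by simp)]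
    exact lintegral_mono fun z => speed_rpow_three_le u Dd z
  have hw2 : ∫⁻ z in Qstar z₀ ρ, gradSpeed Du D2d z ^ (2 : ℝ) = r * BQ Du D2d z₀ ρ := by
    rw [BQ, cancel _ _ hr0 hrt]
    exact lintegral_congr fun z =>
      ofReal_sqrt_rpow_two (add_nonneg (nsq2_nonneg _) (nsq3_nonneg _))
  have hpD : ∀ R, 0 < R → ∫⁻ z in Qstar z₀ R, ‖p z‖ₑ ^ (3 / 2 : ℝ) =
      ENNReal.ofReal (R ^ 2) * DQ p z₀ R := fun R hR => by
    rw [DQ, cancel _ _ (by simpa using hR.ne') ENNReal.ofReal_ne_top]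
    refine lintegral_congr fun z => ?_
    rw [Real.enorm_eq_ofReal_abs, ENNReal.ofReal_rpow_of_nonneg (abs_nonneg _) (by norm_num)]
  have hv2 : ∀ᵐ t ∂(volume.restrict I),
      ∫⁻ y in Metric.ball z₀.1 ρ, speed u Dd (y, t) ^ (2 : ℝ) ≤ r * AQ u Dd z₀ ρ := by
    rw [AQ, cancel _ _ hr0 hrt]
    refine (ENNReal.ae_le_essSup _).mono fun t ht => le_trans (le_of_eq ?_) ht
    exact lintegral_congr fun y => ofReal_sqrt_rpow_two (add_nonneg (sq_nonneg _) (nsq2_nonneg _))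
  have fv : ∫⁻ z in Qstar z₀ ρ, speed u Dd z ^ (2 : ℝ) < ∞ := by
    calc ∫⁻ z in Qstar z₀ ρ, speed u Dd z ^ (2 : ℝ)
        ≤ ∫⁻ z in Qstar z₀ ρ, (1 + speed u Dd z ^ (3 : ℝ)) := by
          refine lintegral_mono fun z => ?_
          rcases le_total (speed u Dd z) 1 with h | h
          · exact (ENNReal.rpow_le_one h (by norm_num)).trans le_self_add
          · exact (ENNReal.rpow_le_rpow_of_exponent_le h (by norm_num)).trans le_add_self
      _ = volume (Qstar z₀ ρ) + ∫⁻ z in Qstar z₀ ρ, speed u Dd z ^ (3 : ℝ) := by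
          rw [lintegral_add_left measurable_const]
          simp
      _ < ∞ := ENNReal.add_lt_top.2 ⟨hQvol, hv3.trans_lt
          (ENNReal.mul_lt_top hr2t.lt_top (ENNReal.mul_lt_top (by simp) hC.lt_top))⟩
  have fw : ∫⁻ z in Qstar z₀ ρ, gradSpeed Du D2d z ^ (2 : ℝ) < ∞ := by
    have h := ((hreg.l2_Du.add hreg.l2_D2d).mono_set hQU).lintegral_lt_top
    refine lt_of_le_of_lt (le_of_eq (lintegral_congr fun z => ?_)) h
    exact ofReal_sqrt_rpow_two (add_nonneg (nsq2_nonneg _) (nsq3_nonneg _))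
  obtain ⟨hGi, hG⟩ := pressureDivEqOn_of_pressureEqOn hQo mu mDu mDd mD2d
    (fun i => memLp_two_of_enorm_le (mu i) (fun z => enorm_apply_le_speed u Dd z i) fv)
    (fun i j => memLp_two_of_enorm_le (mDu i j)
      (fun z => enorm_apply_le_gradSpeed Du D2d z i j) fw)
    (fun i j => memLp_two_of_enorm_le (mDd i j)
      (fun z => enorm_grad_apply_le_speed u Dd z i j) fv)
    (fun i j k => memLp_two_of_enorm_le (mD2d i j k)
      (fun z => enorm_hess_apply_le_gradSpeed Du D2d z i j k) fw)
    (fun i => (hreg.grad_u i).mono hU hQU) (fun i k => (hreg.grad_Dd i k).mono hU hQU)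
    (hpress.mono hU hQU)
  have key := ha z₀.1 ρ I hρ hI p _ _ _ _ hreg.meas_p mv mw
    (fun j z => enorm_stressDiv_le u Du Dd D2d z j)
    (integrableOn_of_rpow hQvol hreg.meas_p (hreg.l32_p.mono_set hQU)) hGi hG hv2 γ hγ
  rw [← hQ, hpD ρ hρ, hw2, hr2] at key
  have hsub : Qstar z₀ (γ * ρ) ⊆ Metric.ball z₀.1 (γ * ρ) ×ˢ I := by
    have h1 : (γ * ρ) ^ 2 ≤ ρ ^ 2 := by
      exact pow_le_pow_left₀ (mul_pos hγ.1 hρ).le (by nlinarith [hγ.2]) 2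
    refine prod_mono le_rfl (Ioo_subset_Ioo ?_ ?_) <;> linarith
  have key2 := pressure_scaling_le hr0 hrt hs0 hst (C := 4 * CQ u Dd z₀ ρ)
    ((lintegral_mono_set hsub).trans (key.trans (by gcongr)))
  have hsr : (ENNReal.ofReal ((γ * ρ) ^ 2))⁻¹ = (s * r) ^ (-2 : ℝ) := by
    rw [ENNReal.rpow_neg, hs_def, hr_def, ← ENNReal.ofReal_mul hγ.1.le,
      ENNReal.ofReal_pow (mul_pos hγ.1 hρ).le]
    norm_cast
  have hDQ : DQ p z₀ (γ * ρ) =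
      (s * r) ^ (-2 : ℝ) * ∫⁻ z in Qstar z₀ (γ * ρ), ‖p z‖ₑ ^ (3 / 2 : ℝ) := by
    rw [hpD _ (mul_pos hγ.1 hρ), ← hsr, ← mul_assoc, ENNReal.inv_mul_cancel
      (by simpa using (mul_pos hγ.1 hρ).ne') ENNReal.ofReal_ne_top, one_mul]
  have h4 : (4 * CQ u Dd z₀ ρ) ^ (1 / 2 : ℝ) = 2 * CQ u Dd z₀ ρ ^ (1 / 2 : ℝ) := by
    rw [ENNReal.mul_rpow_of_nonneg _ _ (by norm_num)]
    congr 1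
    rw [show (4 : ℝ≥0∞) = 2 ^ (2 : ℝ) by norm_num, ← ENNReal.rpow_mul]
    norm_num
  rw [hDQ, ← ENNReal.ofReal_rpow_of_pos hγ.1]
  refine key2.trans (le_trans ?_ (mul_le_mul_left hcle _))
  rw [h4, mul_comm 2 ((a₁ : ℝ≥0∞) + a₂), mul_assoc (_ + _) 2]
  refine mul_le_mul' le_rfl ?_
  rw [mul_add 2, mul_left_comm]
  set A := AQ u Dd z₀ ρ
  set B := BQ Du D2d z₀ ρ
  set D := DQ p z₀ ρ
  set E := CQ u Dd z₀ ρ ^ (1 / 2 : ℝ)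
  have two : ∀ x : ℝ≥0∞, x ≤ 2 * x := fun x => by rw [two_mul]; exact le_self_add
  refine add_le_add (mul_le_mul' le_rfl ?_) (two _)
  calc D + 2 * E ≤ 2 * D + 2 * E := by gcongr; exact two D
    _ = 2 * (D + E) := (mul_add _ _ _).symm
    _ ≤ _ := by gcongr; exact le_self_add
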